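/- Characterization of maximizers when all bubbles but one are planar: Let σ_1, σ_2, σ_3 be permutations of Fin n with bubbles W_0, W_1, …, W_m (orbits of the subgroup generated by {σ_a⁻¹ * σ_b : 1 ≤ a, b ≤ 3}), and suppose the restricted bubbles on W_1, …, W_m are planar (the one on W_0 is arbitrary). Then a permutation σ_0 of Fin n making G = (σ_0, σ_1, σ_2, σ_3) connected maximizes C_0(G) among all such connected graphs if and only if every bubble W_j (j = 0, 1, …, m) satisfies the maximal 2-cut property in G. -/

import Mathlib

/-- The setoid on `α` whose classes are the cycles (orbits) of the permutation `π`. -/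
def permSetoid {α : Type*} (π : Equiv.Perm α) : Setoid α :=
  ⟨π.SameCycle, ⟨fun _ => ⟨0, by simp⟩, fun h => h.symm, fun h h' => h.trans h'⟩⟩

/-- The number of cycles (orbits) of a permutation. -/
noncomputable def numCycles {α : Type*} (π : Equiv.Perm α) : ℕ :=
  Nat.card (Quotient (permSetoid π))

/-- Connectivity of the colored graph `(σ 0, σ 1, σ 2, σ 3)` (case `d = 3`). -/
def ColoredConnected {n : ℕ} (σ : Fin 4 → Equiv.Perm (Fin n)) : Prop :=
  ∀ x y : Fin n,
    ∃ g ∈ Subgroup.closure {g : Equiv.Perm (Fin n) | ∃ a b : Fin 4, g = (σ a)⁻¹ * σ b},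
      g x = y

/-- `C_0(G) = Σ_{c=1}^{3} C_{0c}(G)` at `d = 3`. -/
noncomputable def C0 {n : ℕ} (σ : Fin 4 → Equiv.Perm (Fin n)) : ℕ :=
  numCycles ((σ 1)⁻¹ * σ 0) + numCycles ((σ 2)⁻¹ * σ 0) + numCycles ((σ 3)⁻¹ * σ 0)

/-- The subgroup generated by the bicolored permutations of the colors `1, 2, 3` (given as
`τ 0, τ 1, τ 2`): its orbits are the (white vertex sets of the) bubbles. -/
def bubbleSubgroup {n : ℕ} (τ : Fin 3 → Equiv.Perm (Fin n)) :
    Subgroup (Equiv.Perm (Fin n)) :=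
  Subgroup.closure {g : Equiv.Perm (Fin n) | ∃ a b : Fin 3, g = (τ a)⁻¹ * τ b}

/-- The number of orbits (cycles) of the permutation `π` entirely contained in `W`. -/
noncomputable def orbitsIn {n : ℕ} (π : Equiv.Perm (Fin n)) (W : Set (Fin n)) : ℕ :=
  Nat.card {q : Quotient (permSetoid π) //
    ∀ x : Fin n, Quotient.mk (permSetoid π) x = q → x ∈ W}

/-- The colored graph with colors `{0,1,2,3}` obtained by adjoining the pairing `σ₀` as the
color 0 to the bubble data `τ = (τ 0, τ 1, τ 2)` (standing for colors `1,2,3`). -/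
def withZero {n : ℕ} (σ₀ : Equiv.Perm (Fin n)) (τ : Fin 3 → Equiv.Perm (Fin n)) :
    Fin 4 → Equiv.Perm (Fin n) :=
  Fin.cons σ₀ τ

/-- `G` minus a set `E` of edges (encoded as pairs `(i, c)`) is connected. -/
def minusConnected {n : ℕ} (σ : Fin 4 → Equiv.Perm (Fin n))
    (E : Set (Fin n × Fin 4)) : Prop :=
  ∀ x y : Fin n ⊕ Fin n,
    Relation.EqvGen
      (fun p q => ∃ (i : Fin n) (c : Fin 4),
        (i, c) ∉ E ∧ p = Sum.inl i ∧ q = Sum.inr (σ c i)) x y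

/-- A set `E` of edges of a connected colored graph is an edge-cut if removing it disconnects
the graph while removing any proper subset does not. -/
def IsEdgeCut {n : ℕ} (σ : Fin 4 → Equiv.Perm (Fin n)) (E : Set (Fin n × Fin 4)) : Prop :=
  ¬ minusConnected σ E ∧
    ∀ E' : Set (Fin n × Fin 4), E' ⊂ E → minusConnected σ E'

/-- The bubble with white set `W` and black set `BW` satisfies the **maximal 2-cut property**
in `G`. -/
def MaxTwoCut {n : ℕ} (σ : Fin 4 → Equiv.Perm (Fin n)) (W BW : Set (Fin n))
    (r : Fin 3 → (W ≃ BW)) : Prop :=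
  ∃ π : W ≃ BW,
    (∀ π' : W ≃ BW, (∑ i : Fin 3, numCycles (π'.trans (r i).symm)) ≤
      ∑ i : Fin 3, numCycles (π.trans (r i).symm)) ∧
    ∀ w : W, σ 0 (w : Fin n) = (π w : Fin n) ∨
      ((({((w : Fin n), (0 : Fin 4)), ((σ 0)⁻¹ (π w : Fin n), (0 : Fin 4))} :
          Set (Fin n × Fin 4)).ncard = 2) ∧
        IsEdgeCut σ {((w : Fin n), (0 : Fin 4)), ((σ 0)⁻¹ (π w : Fin n), (0 : Fin 4))})

open Equiv

section Basics
variable {α : Type*}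

/-- Number of classes of a setoid. -/
noncomputable def nc (r : Setoid α) : ℕ := Nat.card (Quotient r)

/-- Explicit join of a setoid with one pair. -/
def jn (r : Setoid α) (x y : α) : Setoid α where
  r s t := r s t ∨ (r s x ∧ r y t) ∨ (r s y ∧ r x t)
  iseqv := by
    refine ⟨fun s => Or.inl (r.refl s), ?_, ?_⟩
    · rintro s t (h | ⟨h, h'⟩ | ⟨h, h'⟩)
      · exact Or.inl (r.symm h)
      · exact Or.inr (Or.inr ⟨r.symm h', r.symm h⟩)
      · exact Or.inr (Or.inl ⟨r.symm h', r.symm h⟩)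
    · rintro s t u (h | ⟨h, h'⟩ | ⟨h, h'⟩) (k | ⟨k, k'⟩ | ⟨k, k'⟩)
      · exact Or.inl (r.trans h k)
      · exact Or.inr (Or.inl ⟨r.trans h k, k'⟩)
      · exact Or.inr (Or.inr ⟨r.trans h k, k'⟩)
      · exact Or.inr (Or.inl ⟨h, r.trans h' k⟩)
      · exact Or.inr (Or.inl ⟨h, k'⟩)
      · exact Or.inl (r.trans h k')
      · exact Or.inr (Or.inr ⟨h, r.trans h' k⟩)
      · exact Or.inl (r.trans h k')
      · exact Or.inr (Or.inr ⟨h, k'⟩)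

theorem jn_iff (r : Setoid α) (x y s t : α) :
    jn r x y s t ↔ r s t ∨ (r s x ∧ r y t) ∨ (r s y ∧ r x t) := Iff.rfl

theorem le_jn (r : Setoid α) (x y : α) : r ≤ jn r x y := fun _ _ h => Or.inl h

theorem jn_pair (r : Setoid α) (x y : α) : jn r x y x y :=
  Or.inr (Or.inl ⟨r.refl x, r.refl y⟩)

theorem jn_le {r r' : Setoid α} {x y : α} (h : r ≤ r') (hxy : r' x y) : jn r x y ≤ r' := by
  rintro s t (k | ⟨k, k'⟩ | ⟨k, k'⟩)
  · exact h k
  · exact r'.trans (h k) (r'.trans hxy (h k'))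
  · exact r'.trans (h k) (r'.trans (r'.symm hxy) (h k'))

theorem jn_eq {r : Setoid α} {x y : α} (h : r x y) : jn r x y = r :=
  le_antisymm (jn_le le_rfl h) (le_jn r x y)

theorem jn_eq_jn {r r' : Setoid α} {x y : α} (h : r ≤ jn r' x y) (h' : r' ≤ jn r x y) :
    jn r x y = jn r' x y :=
  le_antisymm (jn_le h (jn_pair r' x y)) (jn_le h' (jn_pair r x y))

theorem nc_jn [Finite α] {r : Setoid α} {x y : α} (h : ¬ r x y) : nc (jn r x y) + 1 = nc r := by
  classical
  let f : {q : Quotient r // q ≠ Quotient.mk r y} → Quotient (jn r x y) :=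
    fun q => Quotient.map' id (fun _ _ k => le_jn r x y k) q.1
  have hf : Function.Bijective f := by
    constructor
    · rintro ⟨q, hq⟩ ⟨q', hq'⟩ e
      induction q using Quotient.inductionOn with | _ s =>
      induction q' using Quotient.inductionOn with | _ t =>
      have e' : jn r x y s t := Quotient.exact e
      have hs : ¬ r s y := fun k => hq (Quotient.sound k)
      have ht : ¬ r t y := fun k => hq' (Quotient.sound k)
      apply Subtype.ext
      rcases e' with k | ⟨k, k'⟩ | ⟨k, k'⟩
      · exact Quotient.sound k
      · exact absurd (r.symm k') ht
      · exact absurd k hs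
    · intro q
      induction q using Quotient.inductionOn with | _ s =>
      by_cases hs : r s y
      · refine ⟨⟨Quotient.mk r x, fun e => h (Quotient.exact e)⟩, ?_⟩
        apply Quotient.sound
        exact Or.inr (Or.inl ⟨r.refl x, r.symm hs⟩)
      · exact ⟨⟨Quotient.mk r s, fun e => hs (Quotient.exact e)⟩, rfl⟩
  have h1 : Nat.card (Quotient (jn r x y)) = Nat.card {q : Quotient r // q ≠ Quotient.mk r y} :=
    (Nat.card_congr (Equiv.ofBijective f hf)).symm
  have h2 := Nat.card_congr (Equiv.sumCompl (fun q : Quotient r => q = Quotient.mk r y))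
  rw [Nat.card_sum] at h2
  have h3 : Nat.card {q : Quotient r // q = Quotient.mk r y} = 1 := by simp
  unfold nc
  rw [h1, ← h2, h3]
  exact Nat.add_comm _ _

theorem nc_anti [Finite α] {r r' : Setoid α} (h : r ≤ r') : nc r' ≤ nc r := by
  apply Nat.card_le_card_of_surjective (Quotient.map' id (fun _ _ k => h k) : Quotient r → Quotient r')
  intro q
  induction q using Quotient.inductionOn with | _ s =>
  exact ⟨Quotient.mk r s, rfl⟩

theorem eq_of_le_nc [Finite α] {r r' : Setoid α} (h : r ≤ r') (hc : nc r ≤ nc r') : r = r' := by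
  refine le_antisymm h ?_
  intro x y hxy
  by_contra hn
  have h1 := nc_jn hn
  have h2 := nc_anti (jn_le h hxy)
  omega

theorem permSetoid_iff (p : Perm α) (x y : α) : permSetoid p x y ↔ p.SameCycle x y := Iff.rfl

theorem perm_rel (p : Perm α) (y : α) : permSetoid p (p y) y := ⟨-1, by simp⟩

theorem permSetoid_le {p : Perm α} {r : Setoid α} : permSetoid p ≤ r ↔ ∀ y, r (p y) y := by
  constructor
  · intro h y
    exact h (perm_rel p y)
  · rintro h x y ⟨i, rfl⟩
    induction i using Int.induction_on with
    | zero => exact r.refl _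
    | succ i ih =>
      refine r.trans ih (r.symm ?_)
      rw [add_comm, zpow_add, Perm.mul_apply, zpow_one]
      exact h _
    | pred i ih =>
      refine r.trans ih ?_
      have := h ((p ^ (-(i:ℤ) - 1)) x)
      rwa [← Perm.mul_apply, ← zpow_one_add, show 1 + (-(i:ℤ) - 1) = -i by ring] at this

theorem permSetoid_inv (p : Perm α) : permSetoid p⁻¹ = permSetoid p := by
  ext x y
  exact Perm.sameCycle_inv

theorem numCycles_inv (p : Perm α) : numCycles p⁻¹ = numCycles p := by
  unfold numCycles
  rw [permSetoid_inv]

theorem rel_swap [DecidableEq α] {r : Setoid α} {x y : α} (h : r x y) (z : α) :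
    r (swap x y z) z := by
  rcases eq_or_ne z x with rfl | hx
  · rw [swap_apply_left]; exact r.symm h
  rcases eq_or_ne z y with rfl | hy
  · rw [swap_apply_right]; exact h
  rw [swap_apply_of_ne_of_ne hx hy]

/-- In a finite permutation no step is a bridge. -/
theorem no_bridge [Finite α] {p : Perm α} {m : Setoid α} {u : α}
    (h : ∀ t, p.SameCycle u t → t ≠ u → m (p t) t) : m (p u) u := by
  by_contra hn
  have key : ∀ i : ℕ, m ((p ^ (i + 1)) u) (p u) := by
    intro i
    induction i with
    | zero => simp
    | succ i ih =>
      refine m.trans ?_ ih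
      rw [pow_succ' p (i+1), Perm.mul_apply]
      apply h
      · exact ⟨(i + 1 : ℕ), by rw [zpow_natCast]⟩
      · intro e
        rw [e] at ih
        exact hn (m.symm ih)
  obtain ⟨k, hk, hk'⟩ : ∃ k > 0, p ^ k = 1 := by
    have := isOfFinOrder_of_finite p
    exact isOfFinOrder_iff_pow_eq_one.1 this
  have := key (k - 1)
  rw [show k - 1 + 1 = k by omega, hk'] at this
  exact hn (m.symm this)

variable [DecidableEq α]

theorem permSetoid_swap_le (p : Perm α) (x y : α) :
    permSetoid (p * swap x y) ≤ jn (permSetoid p) x y := by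
  rw [permSetoid_le]
  intro z
  exact (jn _ x y).trans (le_jn _ x y (perm_rel p _)) (rel_swap (jn_pair _ x y) z)

theorem permSetoid_jn (p : Perm α) (x y : α) :
    jn (permSetoid (p * swap x y)) x y = jn (permSetoid p) x y := by
  refine jn_eq_jn (permSetoid_swap_le p x y) ?_
  have := permSetoid_swap_le (p * swap x y) x y
  rwa [mul_assoc, swap_mul_self, mul_one] at this

theorem same_of_not_same [Finite α] {p : Perm α} {x y : α} (h : ¬ p.SameCycle x y) :
    (p * swap x y).SameCycle x y := by
  have hb : permSetoid (p * swap x y) (p x) x := by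
    apply no_bridge
    intro t ht htx
    have hty : t ≠ y := fun e => h (e ▸ ht)
    have := perm_rel (p * swap x y) t
    rwa [Perm.mul_apply, swap_apply_of_ne_of_ne htx hty] at this
  have h2 := perm_rel (p * swap x y) y
  rw [Perm.mul_apply, swap_apply_right] at h2
  exact (permSetoid _).trans ((permSetoid _).symm hb) h2

theorem not_same_of_same [Finite α] {p : Perm α} {x y : α} (hne : x ≠ y) (h : p.SameCycle x y) :
    ¬ (p * swap x y).SameCycle x y := by
  classical
  obtain ⟨i, hi⟩ := h.exists_nat_pow_eq
  have hex : ∃ k : ℕ, (p ^ k) x = y := ⟨i, hi⟩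
  let k := Nat.find hex
  have hk : (p ^ k) x = y := Nat.find_spec hex
  have hmin : ∀ j < k, (p ^ j) x ≠ y := fun j hj => Nat.find_min hex hj
  have hk0 : 1 ≤ k := by
    rcases Nat.eq_zero_or_pos k with h0 | h0
    · rw [h0] at hk; exact absurd hk hne
    · exact h0
  have hx : ∀ j, 1 ≤ j → j ≤ k → (p ^ j) x ≠ x := by
    intro j hj hjk e
    have : (p ^ (k - j)) x = y := by
      rw [← hk]
      conv_lhs => rw [← e]
      rw [← Perm.mul_apply, ← pow_add, Nat.sub_add_cancel hjk]
    exact hmin (k - j) (by omega) this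
  intro hs
  let S : Set α := {t | ∃ j, 1 ≤ j ∧ j ≤ k ∧ t = (p ^ j) x}
  have hS : ∀ t ∈ S, (p * swap x y) t ∈ S := by
    rintro t ⟨j, hj, hjk, rfl⟩
    rcases eq_or_lt_of_le hjk with e | hlt
    · refine ⟨1, le_rfl, hk0, ?_⟩
      rw [e, hk, Perm.mul_apply, swap_apply_right, pow_one]
    · refine ⟨j + 1, by omega, hlt, ?_⟩
      rw [Perm.mul_apply, swap_apply_of_ne_of_ne (hx j hj hjk) (hmin j hlt), pow_succ',
        Perm.mul_apply]
  obtain ⟨m, hm⟩ := hs.symm.exists_nat_pow_eq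
  have hall : ∀ m : ℕ, ((p * swap x y) ^ m) y ∈ S := by
    intro m
    induction m with
    | zero => exact ⟨k, hk0, le_rfl, by simp [hk]⟩
    | succ m ih => rw [pow_succ', Perm.mul_apply]; exact hS _ ih
  obtain ⟨j, hj, hjk, e⟩ := hall m
  rw [hm] at e
  exact hx j hj hjk e.symm

theorem numCycles_swap_same [Finite α] {p : Perm α} {x y : α} (hne : x ≠ y)
    (h : p.SameCycle x y) : numCycles (p * swap x y) = numCycles p + 1 := by
  have h1 := nc_jn (r := permSetoid (p * swap x y)) (not_same_of_same hne h)
  rw [permSetoid_jn, jn_eq (r := permSetoid p) h] at h1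
  exact h1.symm

theorem numCycles_swap_not_same [Finite α] {p : Perm α} {x y : α}
    (h : ¬ p.SameCycle x y) : numCycles (p * swap x y) + 1 = numCycles p := by
  have h1 := nc_jn (r := permSetoid p) h
  rw [← permSetoid_jn, jn_eq (r := permSetoid (p * swap x y)) (same_of_not_same h)] at h1
  exact h1

theorem perm_le_of_same {p : Perm α} {x y : α} (h : p.SameCycle x y) :
    permSetoid (p * swap x y) ≤ permSetoid p := by
  have := permSetoid_swap_le p x y
  rwa [jn_eq (r := permSetoid p) h] at this

theorem perm_ge_of_not_same [Finite α] {p : Perm α} {x y : α} (h : ¬ p.SameCycle x y) :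
    permSetoid p ≤ permSetoid (p * swap x y) := by
  have := le_jn (permSetoid p) x y
  rwa [← permSetoid_jn, jn_eq (r := permSetoid (p * swap x y)) (same_of_not_same h)] at this

end Basics

open Equiv

section Graph
variable {α : Type*}

/-- Components of the colored graph `ρ`, seen on white vertices. -/
def K {ι : Type*} (ρ : ι → Perm α) : Setoid α :=
  Relation.EqvGen.setoid (fun x y => ∃ a b, ρ a x = ρ b y)

theorem K_rel {ι : Type*} {ρ : ι → Perm α} {a b : ι} {x y : α} (h : ρ a x = ρ b y) : K ρ x y :=
  Relation.EqvGen.rel _ _ ⟨a, b, h⟩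

theorem K_le {ι : Type*} {ρ : ι → Perm α} {r : Setoid α}
    (h : ∀ a b x y, ρ a x = ρ b y → r x y) : K ρ ≤ r := by
  apply Setoid.eqvGen_le
  rintro x y ⟨a, b, e⟩
  exact h a b x y e

/-- Components of the graph with colors `σ, τ`. -/
def KK (τ : Fin 3 → Perm α) (σ : Perm α) : Setoid α :=
  Relation.EqvGen.setoid (fun x y => (∃ a b, τ a x = τ b y) ∨ ∃ a, τ a x = σ y)

variable {τ : Fin 3 → Perm α} {σ : Perm α}

theorem K_le_KK : K τ ≤ KK τ σ := K_le fun a b _ _ h => Relation.EqvGen.rel _ _ (Or.inl ⟨a, b, h⟩)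

theorem KK_rel {a : Fin 3} {x y : α} (h : τ a x = σ y) : KK τ σ x y :=
  Relation.EqvGen.rel _ _ (Or.inr ⟨a, h⟩)

theorem KK_p (d : Fin 3) (y : α) : KK τ σ ((τ d)⁻¹ (σ y)) y := KK_rel (a := d) (by simp)

theorem K_inv (a b : Fin 3) (β : α) : K τ ((τ a)⁻¹ β) ((τ b)⁻¹ β) :=
  K_rel (a := a) (b := b) (by simp)

theorem KK_le (d : Fin 3) {r : Setoid α} (h : K τ ≤ r) (h' : ∀ y, r ((τ d)⁻¹ (σ y)) y) :
    KK τ σ ≤ r := by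
  apply Setoid.eqvGen_le
  rintro x y (⟨a, b, e⟩ | ⟨a, e⟩)
  · exact h (K_rel e)
  · refine r.trans (h (K_rel (a := a) (b := d) ?_)) (h' y)
    simp [e]

theorem S_le (d : Fin 3) : permSetoid ((τ d)⁻¹ * σ) ≤ KK τ σ :=
  permSetoid_le.2 fun y => KK_p d y

/-- Number of faces containing the color zero. -/
noncomputable def CC (τ : Fin 3 → Perm α) (σ : Perm α) : ℕ :=
  ∑ c : Fin 3, numCycles ((τ c)⁻¹ * σ)

/-- The potential. -/
noncomputable def Ph (τ : Fin 3 → Perm α) (σ : Perm α) : ℤ := (CC τ σ : ℤ) - 3 * (nc (KK τ σ) : ℤ)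

theorem sum3 {a b c : Fin 3} (hab : a ≠ b) (hac : a ≠ c) (hbc : b ≠ c) (f : Fin 3 → ℕ) :
    ∑ i, f i = f a + f b + f c := by
  rw [Fin.sum_univ_three]
  fin_cases a <;> fin_cases b <;> fin_cases c <;> simp_all <;> ring

variable [DecidableEq α]

theorem KK_swap_le (w u : α) : KK τ (σ * swap w u) ≤ jn (KK τ σ) w u := by
  refine KK_le 0 (le_trans K_le_KK (le_jn _ w u)) fun y => ?_
  exact (jn _ w u).trans (le_jn _ w u (KK_p 0 _)) (rel_swap (jn_pair _ w u) y)

theorem KK_jn (w u : α) : jn (KK τ (σ * swap w u)) w u = jn (KK τ σ) w u := by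
  refine jn_eq_jn (KK_swap_le w u) ?_
  have := KK_swap_le (τ := τ) (σ := σ * swap w u) w u
  rwa [mul_assoc, swap_mul_self, mul_one] at this

/-- The two color-0 edges at whites `w`, `u` form a 2-cut. -/
def Good (τ : Fin 3 → Perm α) (σ : Perm α) (w u : α) : Prop := ¬ KK τ (σ * swap w u) w u

theorem good_symm {w u : α} (h : Good τ σ w u) : Good τ σ u w := by
  intro k
  rw [swap_comm] at k
  exact h ((KK _ _).symm k)

theorem good_ne {w u : α} (h : Good τ σ w u) : w ≠ u := by
  rintro rfl
  exact h ((KK _ _).refl _)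

variable [Finite α]

theorem good_S {w u : α} (h : Good τ σ w u) (c : Fin 3) : ((τ c)⁻¹ * σ).SameCycle w u := by
  by_contra hn
  have := same_of_not_same hn
  rw [mul_assoc] at this
  exact h (S_le c this)

theorem good_KK {w u : α} (h : Good τ σ w u) : KK τ σ w u := S_le 0 (good_S h 0)

theorem good_nc {w u : α} (h : Good τ σ w u) :
    nc (KK τ (σ * swap w u)) = nc (KK τ σ) + 1 := by
  have h1 := nc_jn h
  rw [KK_jn, jn_eq (good_KK h)] at h1
  exact h1.symm

theorem not_good_nc {w u : α} (h : ¬ Good τ σ w u) :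
    nc (KK τ (σ * swap w u)) ≤ nc (KK τ σ) := by
  apply nc_anti
  have h' : KK τ (σ * swap w u) w u := not_not.1 h
  have := le_jn (KK τ σ) w u
  rwa [← KK_jn, jn_eq h'] at this

theorem good_iff_nc {w u : α} : Good τ σ w u ↔ nc (KK τ σ) < nc (KK τ (σ * swap w u)) := by
  constructor
  · intro h; rw [good_nc h]; omega
  · intro h
    by_contra hn
    have := not_good_nc hn
    omega

theorem num_same {w u : α} (c : Fin 3) (hne : w ≠ u) (h : ((τ c)⁻¹ * σ).SameCycle w u) :
    numCycles ((τ c)⁻¹ * (σ * swap w u)) = numCycles ((τ c)⁻¹ * σ) + 1 := by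
  rw [← mul_assoc]; exact numCycles_swap_same hne h

theorem num_not_same {w u : α} (c : Fin 3) (h : ¬ ((τ c)⁻¹ * σ).SameCycle w u) :
    numCycles ((τ c)⁻¹ * (σ * swap w u)) + 1 = numCycles ((τ c)⁻¹ * σ) := by
  rw [← mul_assoc]; exact numCycles_swap_not_same h

theorem num_ge {w u : α} (c : Fin 3) :
    numCycles ((τ c)⁻¹ * σ) ≤ numCycles ((τ c)⁻¹ * (σ * swap w u)) + 1 := by
  by_cases h : ((τ c)⁻¹ * σ).SameCycle w u
  · rcases eq_or_ne w u with rfl | hne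
    · have e : (swap w w : Perm α) = 1 := swap_self w
      rw [e, mul_one]; omega
    · have := num_same c hne h; omega
  · have := num_not_same c h; omega

theorem good_Ph {w u : α} (h : Good τ σ w u) : Ph τ (σ * swap w u) = Ph τ σ := by
  have hk := good_nc h
  have hc : ∀ c, numCycles ((τ c)⁻¹ * (σ * swap w u)) = numCycles ((τ c)⁻¹ * σ) + 1 :=
    fun c => num_same c (good_ne h) (good_S h c)
  unfold Ph CC
  simp only [hk, hc, Fin.sum_univ_three]
  push_cast; ring

theorem join_Ph {w u : α} (h : ¬ KK τ σ w u) :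
    Ph τ (σ * swap w u) = Ph τ σ ∧ nc (KK τ (σ * swap w u)) + 1 = nc (KK τ σ) := by
  have hS : ∀ c, ¬ ((τ c)⁻¹ * σ).SameCycle w u := fun c k => h (S_le c k)
  have hc : ∀ c, numCycles ((τ c)⁻¹ * (σ * swap w u)) + 1 = numCycles ((τ c)⁻¹ * σ) :=
    fun c => num_not_same c (hS c)
  have h' : KK τ (σ * swap w u) w u := by
    have := same_of_not_same (hS 0)
    rw [mul_assoc] at this
    exact S_le 0 this
  have hk := nc_jn h
  rw [← KK_jn, jn_eq h'] at hk
  refine ⟨?_, hk⟩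
  have h0 := hc 0
  have h1 := hc 1
  have h2 := hc 2
  unfold Ph CC
  simp only [Fin.sum_univ_three]
  omega

/-- `σ` maximizes the potential. -/
def IsMx (τ : Fin 3 → Perm α) (σ : Perm α) : Prop := ∀ σ', Ph τ σ' ≤ Ph τ σ

theorem good_of_two (hm : IsMx τ σ) {a b c : Fin 3} (hab : a ≠ b) (hac : a ≠ c) (hbc : b ≠ c)
    {w u : α} (hne : w ≠ u)
    (ha : ((τ a)⁻¹ * σ).SameCycle w u) (hb : ((τ b)⁻¹ * σ).SameCycle w u) : Good τ σ w u := by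
  by_contra hn
  have hk := not_good_nc hn
  have h1 := num_same a hne ha
  have h2 := num_same b hne hb
  have h3 := num_ge (τ := τ) (σ := σ) (w := w) (u := u) c
  have := hm (σ * swap w u)
  unfold Ph CC at this
  rw [sum3 hab hac hbc, sum3 hab hac hbc] at this
  omega

theorem perm_iff_of_mapsTo {p : Perm α} {X : Set α} (h : ∀ t ∈ X, p t ∈ X) (t : α) :
    p t ∈ X ↔ t ∈ X := by
  refine ⟨fun ht => ?_, h t⟩
  have h1 := Perm.perm_symm_mapsTo_of_mapsTo p (s := X) h
  have := h1 ht
  simpa using this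

theorem cut_good {X : Set α} (hB : ∀ x y, K τ x y → (x ∈ X ↔ y ∈ X)) (d : Fin 3) {w u : α}
    (hu : u ∉ X) (hw : w ∈ X) (hX : ∀ t ∈ X, t ≠ w → (τ d)⁻¹ (σ t) ∈ X)
    (hpu : (τ d)⁻¹ (σ u) ∈ X) : Good τ σ w u := by
  intro hk
  let r : Setoid α := ⟨fun x y => (x ∈ X ↔ y ∈ X),
    ⟨fun _ => Iff.rfl, fun h => h.symm, fun h h' => h.trans h'⟩⟩
  have hr : KK τ (σ * swap w u) ≤ r := by
    refine KK_le d (fun x y h => hB x y h) ?_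
    intro y
    refine perm_iff_of_mapsTo (p := (τ d)⁻¹ * (σ * swap w u)) ?_ y
    intro t ht
    rcases eq_or_ne t w with rfl | htw
    · simpa using hpu
    · have htu : t ≠ u := fun e => hu (e ▸ ht)
      simpa [swap_apply_of_ne_of_ne htw htu] using hX t ht htw
  exact hu ((hr hk).1 hw)

theorem good_cut {w u : α} (h : Good τ σ w u) :
    ∃ X : Set α, (∀ x y, K τ x y → (x ∈ X ↔ y ∈ X)) ∧ w ∈ X ∧ u ∉ X ∧
      (∀ d, ∀ t ∈ X, t ≠ w → (τ d)⁻¹ (σ t) ∈ X) ∧ (∀ d, (τ d)⁻¹ (σ u) ∈ X) ∧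
      (∀ d, (τ d)⁻¹ (σ w) ∉ X) ∧
      (∀ d t, (τ d)⁻¹ ((σ * swap w u) t) ∈ X ↔ t ∈ X) := by
  have hcl : ∀ d t, KK τ (σ * swap w u) ((τ d)⁻¹ ((σ * swap w u) t)) w ↔
      KK τ (σ * swap w u) t w := fun d t =>
    ⟨fun k => (KK _ _).trans ((KK _ _).symm (KK_p d t)) k, fun k => (KK _ _).trans (KK_p d t) k⟩
  have hu : ¬ KK τ (σ * swap w u) u w := fun k => h ((KK _ _).symm k)
  refine ⟨{t | KK τ (σ * swap w u) t w}, ?_, (KK _ _).refl _, hu, ?_, ?_, ?_, hcl⟩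
  · intro x y hxy
    exact ⟨fun k => (KK _ _).trans ((KK _ _).symm (K_le_KK hxy)) k,
      fun k => (KK _ _).trans (K_le_KK hxy) k⟩
  · intro d t ht htw
    have htu : t ≠ u := fun e => hu (e ▸ ht)
    have := (hcl d t).2 ht
    rwa [Perm.mul_apply, swap_apply_of_ne_of_ne htw htu] at this
  · intro d
    have := (hcl d w).2 ((KK _ _).refl _)
    rwa [Perm.mul_apply, swap_apply_left] at this
  · intro d k
    have := (hcl d u).1 (by rwa [Perm.mul_apply, swap_apply_right])
    exact hu this

end Graph

open Equiv
set_option linter.unusedSectionVars false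

section Reduction
variable {α : Type*}

/-- The color zero does not connect distinct bubbles. -/
def Dec (τ : Fin 3 → Perm α) (σ : Perm α) : Prop := KK τ σ ≤ K τ

theorem dec_nc {τ : Fin 3 → Perm α} {σ : Perm α} (h : Dec τ σ) : nc (KK τ σ) = nc (K τ) := by
  rw [le_antisymm h K_le_KK]

theorem dec_of_nc [Finite α] {τ : Fin 3 → Perm α} {σ : Perm α} (h : nc (K τ) ≤ nc (KK τ σ)) :
    Dec τ σ := (eq_of_le_nc K_le_KK h).ge

theorem dec_rel {τ : Fin 3 → Perm α} {σ : Perm α} (h : Dec τ σ) (d : Fin 3) (y : α) :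
    K τ ((τ d)⁻¹ (σ y)) y := h (KK_p d y)

theorem dec_of_rel {τ : Fin 3 → Perm α} {σ : Perm α} (d : Fin 3)
    (h : ∀ y, K τ ((τ d)⁻¹ (σ y)) y) : Dec τ σ := KK_le d le_rfl h

theorem triv_dec {τ : Fin 3 → Perm α} {σ : Perm α} {w b : α} (ht : ∀ a, τ a w = b)
    (h : Dec τ σ) : σ w = b := by
  let r : Setoid α := ⟨fun x y => (x = w ↔ y = w),
    ⟨fun _ => Iff.rfl, fun h => h.symm, fun h h' => h.trans h'⟩⟩
  have hr : K τ ≤ r := by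
    apply K_le
    intro a c x y e
    constructor
    · rintro rfl
      rw [ht, ← ht c] at e
      exact ((τ c).injective e).symm
    · rintro rfl
      rw [ht, ← ht a] at e
      exact (τ a).injective e
  have h1 := (hr (dec_rel h 0 w)).2 rfl
  rw [← ht 0]
  exact Perm.inv_eq_iff_eq.1 h1

variable [DecidableEq α]

/-- Flip of the edge of color `c` at white `w` and the edge of color `c` at black `b`. -/
def fl (τ : Fin 3 → Perm α) (c : Fin 3) (w b : α) : Fin 3 → Perm α :=
  Function.update τ c (τ c * swap w ((τ c)⁻¹ b))

theorem fl_c (τ : Fin 3 → Perm α) (c : Fin 3) (w b : α) :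
    fl τ c w b c = τ c * swap w ((τ c)⁻¹ b) := by simp [fl]

theorem fl_ne (τ : Fin 3 → Perm α) {a c : Fin 3} (h : a ≠ c) (w b : α) :
    fl τ c w b a = τ a := by simp [fl, h]

theorem fl_w (τ : Fin 3 → Perm α) (c : Fin 3) (w b : α) : fl τ c w b c w = b := by simp [fl_c]

theorem fl_b (τ : Fin 3 → Perm α) (c : Fin 3) (w b : α) :
    fl τ c w b c ((τ c)⁻¹ b) = τ c w := by rw [fl_c]; simp

theorem fl_other (τ : Fin 3 → Perm α) (c : Fin 3) {w b x : α} (h : x ≠ w) (h' : τ c x ≠ b) :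
    fl τ c w b c x = τ c x := by
  rw [fl_c, Perm.mul_apply, swap_apply_of_ne_of_ne h]
  rintro rfl
  simp at h'

theorem K_gen {τ τ' : Fin 3 → Perm α} {r : Setoid α} (hr : K τ' ≤ r)
    (h : ∀ a x, ∃ x', r x' x ∧ τ' a x' = τ a x) : K τ ≤ r := by
  apply K_le
  intro a b x y e
  obtain ⟨x', hx, ex⟩ := h a x
  obtain ⟨y', hy, ey⟩ := h b y
  have : r x' y' := hr (K_rel (a := a) (b := b) (by rw [ex, ey, e]))
  exact r.trans (r.symm hx) (r.trans this hy)

theorem K_wv {τ : Fin 3 → Perm α} {a c : Fin 3} {w b : α} (h : τ a w = b) :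
    K τ w ((τ c)⁻¹ b) := K_rel (a := a) (b := c) (by simp [h])

theorem K_fl_le {τ : Fin 3 → Perm α} {a c : Fin 3} {w b : α} (h : τ a w = b) :
    K (fl τ c w b) ≤ K τ := by
  refine K_gen le_rfl ?_
  intro d x
  rcases eq_or_ne d c with rfl | hd
  · refine ⟨swap w ((τ d)⁻¹ b) x, rel_swap (K_wv h) x, ?_⟩
    rw [fl_c, Perm.mul_apply]
  · exact ⟨x, (K τ).refl x, by rw [fl_ne τ hd]⟩

theorem K_fl {τ : Fin 3 → Perm α} {a c : Fin 3} {w b : α} (h : τ a w = b) :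
    K τ = jn (K (fl τ c w b)) w ((τ c)⁻¹ b) := by
  refine le_antisymm ?_ (jn_le (K_fl_le h) (K_wv h))
  refine K_gen (le_jn _ _ _) ?_
  intro d x
  rcases eq_or_ne d c with rfl | hd
  · refine ⟨swap w ((τ d)⁻¹ b) x, rel_swap (jn_pair _ _ _) x, ?_⟩
    rw [fl_c, Perm.mul_apply, swap_apply_self]
  · exact ⟨x, (jn _ _ _).refl x, by rw [fl_ne τ hd]⟩

theorem KK_fl_le {τ : Fin 3 → Perm α} {σ : Perm α} {a c : Fin 3} {w b : α} (h : τ a w = b)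
    {d : Fin 3} (hd : d ≠ c) : KK (fl τ c w b) σ ≤ KK τ σ := by
  refine KK_le d (le_trans (K_fl_le h) K_le_KK) ?_
  intro y
  rw [fl_ne τ hd]
  exact KK_p d y

theorem KK_fl {τ : Fin 3 → Perm α} {σ : Perm α} {a c : Fin 3} {w b : α} (h : τ a w = b)
    {d : Fin 3} (hd : d ≠ c) : KK τ σ = jn (KK (fl τ c w b) σ) w ((τ c)⁻¹ b) := by
  refine le_antisymm ?_ (jn_le (KK_fl_le h hd) (K_le_KK (K_wv h)))
  refine KK_le d ?_ ?_
  · rw [K_fl (c := c) h]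
    exact jn_le (le_trans K_le_KK (le_jn _ _ _)) (jn_pair _ _ _)
  · intro y
    apply le_jn
    rw [← fl_ne τ hd w b]
    exact KK_p d y

theorem nc_le_jn [Finite α] (r : Setoid α) (x y : α) : nc r ≤ nc (jn r x y) + 1 := by
  by_cases h : r x y
  · rw [jn_eq h]; omega
  · rw [nc_jn h]

/-- Composable reduction data. -/
structure Rd (d : Fin 3) (P : Perm α → Prop) (τ τ' : Fin 3 → Perm α) (x : ℕ) : Prop where
  hd : τ' d = τ d
  hK : K τ' ≤ K τ
  hn : ∀ σ, nc (KK τ' σ) + nc (K τ) ≤ nc (KK τ σ) + nc (K τ')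
  hC : ∀ σ, P σ → CC τ' σ = CC τ σ + x

theorem Rd.comp {d : Fin 3} {P : Perm α → Prop} {τ τ' τ'' : Fin 3 → Perm α} {x y : ℕ}
    (h : Rd d P τ τ' x) (h' : Rd d P τ' τ'' y) : Rd d P τ τ'' (x + y) where
  hd := h'.hd.trans h.hd
  hK := le_trans h'.hK h.hK
  hn σ := by have := h.hn σ; have := h'.hn σ; omega
  hC σ hσ := by rw [h'.hC σ hσ, h.hC σ hσ]; ring

variable [Finite α]

theorem Rd.step {a c e d : Fin 3} (hac : a ≠ c) (hae : a ≠ e) (hce : c ≠ e) (hdc : d ≠ c)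
    {P : Perm α → Prop}
    {τ : Fin 3 → Perm α} {w b : α} (h : τ a w = b) (hP : ∀ σ, P σ → σ w = b) :
    ∃ x, Rd d P τ (fl τ c w b) x := by
  classical
  refine ⟨if w = (τ c)⁻¹ b then 0 else 1, fl_ne τ hdc w b, K_fl_le h, ?_, ?_⟩
  · intro σ
    rw [KK_fl h hdc (σ := σ), K_fl (c := c) h]
    by_cases hk : K (fl τ c w b) w ((τ c)⁻¹ b)
    · rw [jn_eq hk, jn_eq (K_le_KK hk)]
    · have := nc_jn hk
      have := nc_le_jn (KK (fl τ c w b) σ) w ((τ c)⁻¹ b)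
      omega
  · intro σ hσ
    have hw := hP σ hσ
    unfold CC
    rw [sum3 hac hae hce, sum3 hac hae hce, fl_ne τ hac, fl_ne τ (Ne.symm hce), fl_c]
    have e1 : numCycles ((τ c * swap w ((τ c)⁻¹ b))⁻¹ * σ)
        = numCycles (σ⁻¹ * τ c * swap w ((τ c)⁻¹ b)) := by
      rw [← numCycles_inv]; congr 1
    have e2 : numCycles ((τ c)⁻¹ * σ) = numCycles (σ⁻¹ * τ c) := by
      rw [← numCycles_inv]; congr 1
    rw [e1, e2]
    split_ifs with hwv
    · rw [← hwv]
      have e : (swap w w : Perm α) = 1 := swap_self w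
      rw [e, mul_one]; omega
    · rw [numCycles_swap_same hwv]
      · omega
      · have := perm_rel (σ⁻¹ * τ c) ((τ c)⁻¹ b)
        have e : (σ⁻¹ * τ c) ((τ c)⁻¹ b) = w := by simp [← hw]
        rwa [e] at this

/-- The statement proven by induction over reductions. -/
def TT (τ : Fin 3 → Perm α) : Prop :=
  ∀ σ, IsMx τ σ → (∀ w u, ¬ Good τ σ w u) → Dec τ σ

theorem exists_Mx (τ : Fin 3 → Perm α) : ∃ σ, IsMx τ σ := Finite.exists_max (Ph τ)

theorem TT.exists_dec {τ : Fin 3 → Perm α} (h : TT τ) : ∃ σ, Dec τ σ ∧ IsMx τ σ := by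
  obtain ⟨σ0, h0⟩ := exists_Mx τ
  have : Nonempty {σ // IsMx τ σ} := ⟨⟨σ0, h0⟩⟩
  obtain ⟨⟨σ, hσ⟩, hmax⟩ := Finite.exists_max (fun σ : {σ // IsMx τ σ} => nc (KK τ σ.1))
  refine ⟨σ, h σ hσ ?_, hσ⟩
  intro w u hg
  have h1 := hmax ⟨σ * swap w u, fun σ' => by rw [good_Ph hg]; exact hσ σ'⟩
  have h2 := good_nc hg
  simp only at h1
  omega

theorem Rd.TT {d : Fin 3} {P : Perm α → Prop} {τ τ' : Fin 3 → Perm α} {x : ℕ}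
    (hR : Rd d P τ τ' x) (hT : TT τ') (hdP : ∀ σ, Dec τ' σ → P σ) {σ : Perm α} (hσ : P σ)
    (hm : IsMx τ σ) (hg : ∀ w u, ¬ Good τ σ w u) : Dec τ σ := by
  have hDD : ∀ σ, Dec τ' σ → Dec τ σ := by
    intro σ h
    refine dec_of_rel d fun y => hR.hK ?_
    rw [← hR.hd]
    exact dec_rel h d y
  obtain ⟨σ', hD', hm'⟩ := hT.exists_dec
  have hP' := hdP _ hD'
  have hD := hDD _ hD'
  have e1 := dec_nc hD'
  have e2 := dec_nc hD
  have e3 := hR.hC _ hP'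
  have e4 := hR.hC _ hσ
  have i1 := hm' σ
  have i2 := hm σ'
  have i3 := hR.hn σ
  have i1' := i1
  unfold Ph at i1' i2
  have hmm : IsMx τ' σ := by
    intro ρ
    refine le_trans (hm' ρ) ?_
    unfold Ph
    omega
  apply hDD
  apply hT σ hmm
  intro w u hgood
  have j1 := good_nc hgood
  have j2 := hR.hn (σ * swap w u)
  have j3 := not_good_nc (hg w u)
  omega

theorem all3 {a b c : Fin 3} (hab : a ≠ b) (hac : a ≠ c) (hbc : b ≠ c) :
    ∀ d : Fin 3, d = a ∨ d = b ∨ d = c := by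
  decide +revert

/-- The A-reduction of a face of length four. -/
def AR (τ : Fin 3 → Perm α) (a b c : Fin 3) (w1 w2 : α) : Fin 3 → Perm α :=
  fl (fl (fl τ c w1 (τ a w1)) c w2 (τ a w2)) b w1 (τ a w1)

theorem stepA {τ : Fin 3 → Perm α} {σ : Perm α} {a b c : Fin 3} (hab : a ≠ b) (hac : a ≠ c)
    (hbc : b ≠ c) {w1 w2 : α} (hw : w1 ≠ w2) (h1 : τ a w1 = τ b w2) (h2 : τ b w1 = τ a w2)
    (hT : TT (AR τ a b c w1 w2)) (hm : IsMx τ σ) (hg : ∀ w u, ¬ Good τ σ w u)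
    (hs1 : σ w1 = τ a w1) (hs2 : σ w2 = τ a w2) : Dec τ σ := by
  have hb : τ a w1 ≠ τ a w2 := fun e => hw ((τ a).injective e)
  let P : Perm α → Prop := fun σ => σ w1 = τ a w1 ∧ σ w2 = τ a w2
  obtain ⟨x1, R1⟩ := Rd.step (d := a) (P := P) hac hab hbc.symm hac (w := w1) rfl (fun σ h => h.1)
  obtain ⟨x2, R2⟩ := Rd.step (τ := fl τ c w1 (τ a w1)) (d := a) (P := P) hac hab hbc.symm hac
    (w := w2) (b := τ a w2) (by rw [fl_ne τ hac]) (fun σ h => h.2)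
  obtain ⟨x3, R3⟩ := Rd.step (τ := fl (fl τ c w1 (τ a w1)) c w2 (τ a w2)) (d := a) (P := P)
    hab hac hbc hab
    (w := w1) (b := τ a w1) (by rw [fl_ne _ hac, fl_ne _ hac]) (fun σ h => h.1)
  refine ((R1.comp R2).comp R3).TT hT ?_ ⟨hs1, hs2⟩ hm hg
  have hall := all3 hab hac hbc
  intro σ' hD
  constructor
  · apply triv_dec (τ := AR τ a b c w1 w2) _ hD
    intro d
    rcases hall d with rfl | rfl | rfl
    · simp [AR, fl_ne _ hab, fl_ne _ hac]
    · simp [AR, fl_w]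
    · rw [AR, fl_ne _ hbc.symm, fl_other _ _ hw, fl_w]
      rw [fl_w]; exact hb
  · apply triv_dec (τ := AR τ a b c w1 w2) _ hD
    intro d
    rcases hall d with rfl | rfl | rfl
    · simp [AR, fl_ne _ hab, fl_ne _ hac]
    · have : w2 = ((fl (fl τ c w1 (τ a w1)) c w2 (τ a w2)) d)⁻¹ (τ a w1) := by
        rw [fl_ne _ hbc, fl_ne _ hbc, h1]; simp
      rw [AR]
      have h3 := fl_b (fl (fl τ c w1 (τ a w1)) c w2 (τ a w2)) d w1 (τ a w1)
      rw [← this] at h3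
      rw [h3, fl_ne _ hbc, fl_ne _ hbc, h2]
    · rw [AR, fl_ne _ hbc.symm, fl_w]

end Reduction

open Equiv
set_option linter.unusedSectionVars false

section Four
variable {α : Type*} [DecidableEq α] [Finite α]

theorem inv_app (p : Perm α) (x : α) : p⁻¹ (p x) = x := p.symm_apply_apply x

theorem app_inv (p : Perm α) (x : α) : p (p⁻¹ x) = x := p.apply_symm_apply x

theorem no_bridge' {p : Perm α} {m : Setoid α} {u : α}
    (h : ∀ t, p.SameCycle u t → m t u ∨ m (p t) t) : m (p u) u := by
  by_contra hn
  have key : ∀ i : ℕ, m ((p ^ (i + 1)) u) (p u) := by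
    intro i
    induction i with
    | zero => simp
    | succ i ih =>
      refine m.trans ?_ ih
      rw [pow_succ' p (i+1), Perm.mul_apply]
      rcases h ((p ^ (i + 1)) u) ⟨(i + 1 : ℕ), by rw [zpow_natCast]⟩ with h1 | h1
      · exact absurd (m.trans (m.symm ih) h1) hn
      · exact h1
  obtain ⟨k, hk, hk'⟩ : ∃ k > 0, p ^ k = 1 :=
    isOfFinOrder_iff_pow_eq_one.1 (isOfFinOrder_of_finite p)
  have := key (k - 1)
  rw [show k - 1 + 1 = k by omega, hk'] at this
  exact hn (m.symm this)

theorem inv_same {p : Perm α} {X : Set α} (h : ∀ t ∈ X, p t ∈ X) {x y : α}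
    (hxy : p.SameCycle x y) (hx : x ∈ X) : y ∈ X := by
  let r : Setoid α := ⟨fun x y => (x ∈ X ↔ y ∈ X),
    ⟨fun _ => Iff.rfl, fun h => h.symm, fun h h' => h.trans h'⟩⟩
  have hr : permSetoid p ≤ r := permSetoid_le.2 fun y => perm_iff_of_mapsTo h y
  exact (hr hxy).1 hx

/-- A white set cut off by two color-0 edges. -/
structure Cut (τ : Fin 3 → Perm α) (σ : Perm α) (x y : α) (X : Set α) : Prop where
  cl : ∀ s t, K τ s t → (s ∈ X ↔ t ∈ X)
  hx : x ∈ X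
  hy : y ∉ X
  int : ∀ d, ∀ t ∈ X, t ≠ x → (τ d)⁻¹ (σ t) ∈ X
  out : ∀ d t, t ∉ X → t ≠ y → (τ d)⁻¹ (σ t) ∉ X
  py : ∀ d, (τ d)⁻¹ (σ y) ∈ X
  px : ∀ d, (τ d)⁻¹ (σ x) ∉ X

theorem Cut.compl {τ : Fin 3 → Perm α} {σ : Perm α} {x y : α} {X : Set α} (h : Cut τ σ x y X) :
    Cut τ σ y x Xᶜ where
  cl s t k := not_congr (h.cl s t k)
  hx := h.hy
  hy := fun k => k h.hx
  int d t ht hne := h.out d t ht hne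
  out d t ht hne := fun k => k (h.int d t (not_not.1 ht) hne)
  py d := h.px d
  px d := fun k => k (h.py d)

theorem Good.cut {τ : Fin 3 → Perm α} {σ : Perm α} {x y : α} (h : Good τ σ x y) :
    ∃ X, Cut τ σ x y X := by
  obtain ⟨X, h1, h2, h3, h4, h5, h6, h7⟩ := good_cut h
  refine ⟨X, h1, h2, h3, h4, ?_, h5, h6⟩
  intro d t ht hne k
  have htx : t ≠ x := fun e => ht (e ▸ h2)
  apply ht
  apply (h7 d t).1
  rwa [Perm.mul_apply, swap_apply_of_ne_of_ne htx hne]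

theorem Cut.good {τ : Fin 3 → Perm α} {σ : Perm α} {x y : α} {X : Set α} (h : Cut τ σ x y X) :
    Good τ σ x y := cut_good h.cl 0 h.hy h.hx (h.int 0) (h.py 0)

theorem Cut.cross {τ : Fin 3 → Perm α} {σ : Perm α} {x y : α} {X : Set α} (h : Cut τ σ x y X)
    {d : Fin 3} {t t' : α} (ht : t ∈ X) (ht' : t' ∉ X)
    (hs : ((τ d)⁻¹ * σ).SameCycle t t') : ((τ d)⁻¹ * σ).SameCycle t x := by
  by_contra hn
  have := inv_same (p := (τ d)⁻¹ * σ) (X := {s | s ∈ X ∧ ((τ d)⁻¹ * σ).SameCycle t s}) ?_ hs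
    ⟨ht, Perm.SameCycle.refl _ _⟩
  · exact ht' this.1
  · rintro s ⟨hs1, hs2⟩
    refine ⟨h.int d s hs1 ?_, Perm.sameCycle_apply_right.2 hs2⟩
    rintro rfl
    exact hn hs2

/-- The configuration of a face of length four without short pairing. -/
structure Fr (τ : Fin 3 → Perm α) (σ : Perm α) (a b c : Fin 3) (w1 w2 u1 u2 : α) : Prop where
  hab : a ≠ b
  hac : a ≠ c
  hbc : b ≠ c
  hm : IsMx τ σ
  e1 : σ u1 = τ a w1
  e2 : σ u1 = τ b w2
  e3 : σ u2 = τ a w2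
  e4 : σ u2 = τ b w1
  w12 : w1 ≠ w2
  u12 : u1 ≠ u2
  d11 : w1 ≠ u1
  d12 : w1 ≠ u2
  d21 : w2 ≠ u1
  d22 : w2 ≠ u2
  c11 : ¬ ((τ c)⁻¹ * σ).SameCycle w1 u1
  c12 : ¬ ((τ c)⁻¹ * σ).SameCycle w1 u2
  c21 : ¬ ((τ c)⁻¹ * σ).SameCycle w2 u1
  c22 : ¬ ((τ c)⁻¹ * σ).SameCycle w2 u2

variable {τ : Fin 3 → Perm α} {σ : Perm α} {a b c : Fin 3} {w1 w2 u1 u2 : α}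

theorem Fr.swI (h : Fr τ σ a b c w1 w2 u1 u2) : Fr τ σ a b c w2 w1 u2 u1 :=
  ⟨h.hab, h.hac, h.hbc, h.hm, h.e3, h.e4, h.e1, h.e2, h.w12.symm, h.u12.symm, h.d22, h.d21,
    h.d12, h.d11, h.c22, h.c21, h.c12, h.c11⟩

theorem Fr.swA (h : Fr τ σ a b c w1 w2 u1 u2) : Fr τ σ b a c w1 w2 u2 u1 :=
  ⟨h.hab.symm, h.hbc, h.hac, h.hm, h.e4, h.e3, h.e2, h.e1, h.w12, h.u12.symm, h.d12, h.d11,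
    h.d22, h.d21, h.c12, h.c11, h.c22, h.c21⟩

/-- The double flip. -/
def sA (σ : Perm α) (w1 w2 u1 u2 : α) : Perm α := σ * swap w1 u1 * swap w2 u2

theorem Fr.A_w1 (h : Fr τ σ a b c w1 w2 u1 u2) : sA σ w1 w2 u1 u2 w1 = σ u1 := by
  rw [sA, Perm.mul_apply, swap_apply_of_ne_of_ne h.w12 h.d12, Perm.mul_apply, swap_apply_left]

theorem Fr.A_w2 (h : Fr τ σ a b c w1 w2 u1 u2) : sA σ w1 w2 u1 u2 w2 = σ u2 := by
  rw [sA, Perm.mul_apply, swap_apply_left, Perm.mul_apply,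
    swap_apply_of_ne_of_ne h.d12.symm h.u12.symm]

theorem Fr.A_u1 (h : Fr τ σ a b c w1 w2 u1 u2) : sA σ w1 w2 u1 u2 u1 = σ w1 := by
  rw [sA, Perm.mul_apply, swap_apply_of_ne_of_ne h.d21.symm h.u12, Perm.mul_apply,
    swap_apply_right]

theorem Fr.A_u2 (h : Fr τ σ a b c w1 w2 u1 u2) : sA σ w1 w2 u1 u2 u2 = σ w2 := by
  rw [sA, Perm.mul_apply, swap_apply_right, Perm.mul_apply,
    swap_apply_of_ne_of_ne h.w12.symm h.d21]

theorem A_other {t : α} (h1 : t ≠ w1) (h2 : t ≠ w2) (h3 : t ≠ u1) (h4 : t ≠ u2) :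
    sA σ w1 w2 u1 u2 t = σ t := by
  rw [sA, Perm.mul_apply, swap_apply_of_ne_of_ne h2 h4, Perm.mul_apply,
    swap_apply_of_ne_of_ne h1 h3]

theorem Fr.A_comm (h : Fr τ σ a b c w1 w2 u1 u2) : sA σ w2 w1 u2 u1 = sA σ w1 w2 u1 u2 := by
  ext t
  by_cases h1 : t = w1
  · rw [h1, h.A_w1, h.swI.A_w2]
  by_cases h2 : t = w2
  · rw [h2, h.A_w2, h.swI.A_w1]
  by_cases h3 : t = u1
  · rw [h3, h.A_u1, h.swI.A_u2]
  by_cases h4 : t = u2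
  · rw [h4, h.A_u2, h.swI.A_u1]
  rw [A_other h1 h2 h3 h4, A_other h2 h1 h4 h3]

theorem Fr.kw (h : Fr τ σ a b c w1 w2 u1 u2) : K τ w1 w2 :=
  K_rel (a := a) (b := b) (by rw [← h.e1, h.e2])

theorem Fr.r1 (h : Fr τ σ a b c w1 w2 u1 u2) : KK τ (sA σ w1 w2 u1 u2) w1 u1 := by
  have h1 : KK τ (sA σ w1 w2 u1 u2) (((τ c)⁻¹ * σ) w1) w1 := by
    apply no_bridge'
    intro t ht
    by_cases h1 : t = w1
    · left; rw [h1]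
    by_cases h2 : t = w2
    · left; rw [h2]; exact (KK _ _).symm (K_le_KK h.kw)
    right
    have h3 : t ≠ u1 := fun e => h.c11 (e ▸ ht)
    have h4 : t ≠ u2 := fun e => h.c12 (e ▸ ht)
    rw [Perm.mul_apply, ← A_other h1 h2 h3 h4]
    exact KK_p c t
  rw [Perm.mul_apply, ← h.A_u1] at h1
  exact (KK _ _).trans ((KK _ _).symm h1) (KK_p c u1)

theorem Fr.r2 (h : Fr τ σ a b c w1 w2 u1 u2) : KK τ (sA σ w1 w2 u1 u2) w2 u2 := by
  have := h.swI.r1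
  rwa [h.A_comm] at this

theorem Fr.le (h : Fr τ σ a b c w1 w2 u1 u2) : KK τ σ ≤ KK τ (sA σ w1 w2 u1 u2) := by
  refine KK_le c K_le_KK ?_
  intro t
  by_cases h1 : t = w1
  · rw [h1, ← h.A_u1]; exact (KK _ _).trans (KK_p c u1) ((KK _ _).symm h.r1)
  by_cases h2 : t = w2
  · rw [h2, ← h.A_u2]; exact (KK _ _).trans (KK_p c u2) ((KK _ _).symm h.r2)
  by_cases h3 : t = u1
  · rw [h3, ← h.A_w1]; exact (KK _ _).trans (KK_p c w1) h.r1
  by_cases h4 : t = u2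
  · rw [h4, ← h.A_w2]; exact (KK _ _).trans (KK_p c w2) h.r2
  rw [← A_other h1 h2 h3 h4]; exact KK_p c t

theorem Fr.Sb1 (h : Fr τ σ a b c w1 w2 u1 u2) :
    ((τ b)⁻¹ * (σ * swap w1 u1)).SameCycle w1 u2 ∧
    ((τ b)⁻¹ * (σ * swap w1 u1)).SameCycle w2 u2 := by
  have hb1 := perm_rel ((τ b)⁻¹ * (σ * swap w1 u1)) u2
  have hb2 := perm_rel ((τ b)⁻¹ * (σ * swap w1 u1)) w1
  have e1 : ((τ b)⁻¹ * (σ * swap w1 u1)) u2 = w1 := by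
    rw [Perm.mul_apply, Perm.mul_apply, swap_apply_of_ne_of_ne h.d12.symm h.u12.symm, h.e4,
      inv_app]
  have e2 : ((τ b)⁻¹ * (σ * swap w1 u1)) w1 = w2 := by
    rw [Perm.mul_apply, Perm.mul_apply, swap_apply_left, h.e2, inv_app]
  rw [e1] at hb1
  rw [e2] at hb2
  exact ⟨hb1, (permSetoid _).trans hb2 hb1⟩

theorem Fr.Sa (h : Fr τ σ a b c w1 w2 u1 u2) : ((τ a)⁻¹ * σ).SameCycle w1 u1 := by
  have := perm_rel ((τ a)⁻¹ * σ) u1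
  have e : ((τ a)⁻¹ * σ) u1 = w1 := by rw [Perm.mul_apply, h.e1, inv_app]
  rwa [e] at this

theorem Fr.Sa1 (h : Fr τ σ a b c w1 w2 u1 u2) :
    ((τ a)⁻¹ * (σ * swap w1 u1)).SameCycle w2 u2 := by
  have := perm_rel ((τ a)⁻¹ * (σ * swap w1 u1)) u2
  have e : ((τ a)⁻¹ * (σ * swap w1 u1)) u2 = w2 := by
    rw [Perm.mul_apply, Perm.mul_apply, swap_apply_of_ne_of_ne h.d12.symm h.u12.symm, h.e3,
      inv_app]
  rwa [e] at this

theorem Fr.main (h : Fr τ σ a b c w1 w2 u1 u2) :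
    IsMx τ (sA σ w1 w2 u1 u2) ∧ nc (KK τ (sA σ w1 w2 u1 u2)) = nc (KK τ σ) ∧
    ¬ ((τ b)⁻¹ * σ).SameCycle w1 u1 ∧ ¬ ((τ c)⁻¹ * (σ * swap w1 u1)).SameCycle w2 u2 := by
  have i1 := nc_anti h.le
  have a1 := num_same a h.d11 h.Sa
  have a2 := num_same a h.d22 h.Sa1
  have b1 := num_ge (τ := τ) (σ := σ) (w := w1) (u := u1) b
  have b2 := num_same b h.d22 h.Sb1.2
  have c1 := num_not_same c h.c11
  have c2 := num_ge (τ := τ) (σ := σ * swap w1 u1) (w := w2) (u := u2) c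
  have hmx := h.hm (sA σ w1 w2 u1 u2)
  have hmx' := hmx
  unfold Ph CC at hmx'
  rw [sum3 h.hab h.hac h.hbc, sum3 h.hab h.hac h.hbc] at hmx'
  unfold sA at hmx' i1 ⊢
  refine ⟨?_, ?_, ?_, ?_⟩
  · intro ρ
    refine le_trans (h.hm ρ) ?_
    unfold Ph CC
    rw [sum3 h.hab h.hac h.hbc, sum3 h.hab h.hac h.hbc]
    omega
  · omega
  · intro k
    have := num_same b h.d11 k
    omega
  · intro k
    have := num_same c h.d22 k
    omega

theorem Fr.F1 (h : Fr τ σ a b c w1 w2 u1 u2) :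
    ((τ c)⁻¹ * sA σ w1 w2 u1 u2).SameCycle w1 u1 := by
  have h1 := same_of_not_same h.c11
  rw [mul_assoc] at h1
  have h2 := perm_ge_of_not_same h.main.2.2.2
  rw [mul_assoc] at h2
  exact h2 h1

theorem Fr.F2 (h : Fr τ σ a b c w1 w2 u1 u2) :
    ((τ c)⁻¹ * sA σ w1 w2 u1 u2).SameCycle w2 u2 := by
  have := h.swI.F1
  rwa [h.A_comm] at this

theorem Fr.F3 (h : Fr τ σ a b c w1 w2 u1 u2) :
    ((τ b)⁻¹ * sA σ w1 w2 u1 u2).SameCycle u1 u2 := by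
  have h1 := same_of_not_same h.main.2.2.1
  rw [mul_assoc] at h1
  have h2 : ((τ b)⁻¹ * (σ * swap w1 u1)).SameCycle u1 u2 := h1.symm.trans h.Sb1.1
  have h3 := le_jn (permSetoid _) w2 u2 h2
  rw [← permSetoid_jn, mul_assoc] at h3
  have key : ¬ ((τ b)⁻¹ * sA σ w1 w2 u1 u2).SameCycle w2 u1 := by
    intro k
    have := inv_same (X := {w1, w2}) ?_ k (by simp)
    · rcases this with e | e
      · exact h.d11 e.symm
      · exact h.d21 e.symm
    · rintro t (rfl | rfl)
      · right; rw [Perm.mul_apply, h.A_w1, h.e2]; simp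
      · left; rw [Perm.mul_apply, h.A_w2, h.e4]; simp
  rcases h3 with k | ⟨k, -⟩ | ⟨k, -⟩
  · exact k
  · exact absurd k.symm key
  · exact k

theorem Fr.F4 (h : Fr τ σ a b c w1 w2 u1 u2) :
    ¬ ((τ a)⁻¹ * sA σ w1 w2 u1 u2).SameCycle u1 u2 := by
  intro k
  have h1 := perm_le_of_same h.Sa1
  have h2 := perm_le_of_same h.Sa
  rw [mul_assoc] at h1 h2
  have h3 : ((τ a)⁻¹ * σ).SameCycle u1 u2 := h2 (h1 k)
  exact h.swA.main.2.2.1 (h.Sa.trans h3)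

theorem Fr.N (h : Fr τ σ a b c w1 w2 u1 u2) (hg : ∀ w u, ¬ Good τ σ w u) {X : Set α} {x y : α}
    (hB : ∀ x y, K τ x y → (x ∈ X ↔ y ∈ X)) (hx : x ∈ X) (hy : y ∉ X) (hw : w1 ∉ X)
    (hinX : ∀ t ∈ X, t ≠ x → (τ a)⁻¹ (sA σ w1 w2 u1 u2 t) ∈ X)
    (hpy : (τ a)⁻¹ (sA σ w1 w2 u1 u2 y) ∈ X) (hu1 : u1 ∈ X → u1 = x) (hu2 : u2 ∈ X → u2 = x) :
    False := by
  have hw2 : w2 ∉ X := fun k => hw ((hB _ _ h.kw).2 k)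
  have y1 : y ≠ w1 := by
    rintro rfl
    rw [h.A_w1, h.e1, inv_app] at hpy
    exact hw hpy
  have y2 : y ≠ w2 := by
    rintro rfl
    rw [h.A_w2, h.e3, inv_app] at hpy
    exact hw2 hpy
  obtain ⟨y', hy', ey⟩ : ∃ y', y' ∉ X ∧ σ y' = sA σ w1 w2 u1 u2 y := by
    by_cases h3 : y = u1
    · exact ⟨w1, hw, by rw [h3, h.A_u1]⟩
    by_cases h4 : y = u2
    · exact ⟨w2, hw2, by rw [h4, h.A_u2]⟩
    exact ⟨y, hy, by rw [A_other y1 y2 h3 h4]⟩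
  refine hg x y' (cut_good hB a hy' hx ?_ (by rwa [ey]))
  intro t ht htx
  rw [← A_other (σ := σ) (w1 := w1) (w2 := w2) (u1 := u1) (u2 := u2)]
  · exact hinX t ht htx
  · rintro rfl; exact hw ht
  · rintro rfl; exact hw2 ht
  · rintro rfl; exact htx (hu1 ht)
  · rintro rfl; exact htx (hu2 ht)

theorem Fr.ii (h : Fr τ σ a b c w1 w2 u1 u2) (hg : ∀ w u, ¬ Good τ σ w u) {X : Set α} {x y : α}
    (hX : Cut τ (sA σ w1 w2 u1 u2) x y X) (hw : w1 ∉ X) (h1 : u1 ∈ X) (h1' : u1 ≠ x)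
    (h2 : u2 ∈ X → u2 = x) : False := by
  have hc := hX.cross h1 hw h.F1.symm
  have hb : ((τ b)⁻¹ * sA σ w1 w2 u1 u2).SameCycle u1 x := by
    by_cases k : u2 ∈ X
    · rw [← h2 k]; exact h.F3
    · exact hX.cross h1 k h.F3
  have hgd := good_symm (good_of_two h.main.1 h.hbc h.hab.symm h.hac.symm h1' hb hc)
  obtain ⟨Y, hY⟩ := hgd.cut
  refine h.N hg (X := X ∩ Y) (x := x) (y := u1) ?_ ⟨hX.hx, hY.hx⟩ (fun k => hY.hy k.2)
    (fun k => hw k.1) ?_ ⟨hX.int a u1 h1 h1', hY.py a⟩ (fun k => absurd k.2 hY.hy)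
    (fun k => h2 k.1)
  · intro s t k
    exact and_congr (hX.cl s t k) (hY.cl s t k)
  · intro t ht htx
    exact ⟨hX.int a t ht.1 htx, hY.int a t ht.2 htx⟩

theorem Fr.ng (h : Fr τ σ a b c w1 w2 u1 u2) (hg : ∀ w u, ¬ Good τ σ w u) {X : Set α} {x y : α}
    (hX : Cut τ (sA σ w1 w2 u1 u2) x y X) (hw : w1 ∉ X) : False := by
  have hw2 : w2 ∉ X := fun k => hw ((hX.cl _ _ h.kw).2 k)
  by_cases h1 : u1 ∈ X → u1 = x
  · by_cases h2 : u2 ∈ X → u2 = x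
    · exact h.N hg hX.cl hX.hx hX.hy hw (hX.int a) (hX.py a) h1 h2
    · push Not at h2
      have hX' := hX
      rw [← h.A_comm] at hX'
      exact h.swI.ii hg hX' hw2 h2.1 h2.2 h1
  · push Not at h1
    by_cases h2 : u2 ∈ X → u2 = x
    · exact h.ii hg hX hw h1.1 h1.2 h2
    · push Not at h2
      have c1 := hX.cross h1.1 hw h.F1.symm
      have c2 := hX.cross h2.1 hw2 h.F2.symm
      have := good_of_two h.main.1 h.hbc h.hab.symm h.hac.symm h.u12 h.F3 (c1.trans c2.symm)
      exact h.F4 (good_S this a)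

theorem Fr.dec (h : Fr τ σ a b c w1 w2 u1 u2) (hg : ∀ w u, ¬ Good τ σ w u)
    (hT : TT (AR τ a b c w1 w2)) : Dec τ σ := by
  have h1 : Dec τ (sA σ w1 w2 u1 u2) := by
    refine stepA h.hab h.hac h.hbc h.w12 (by rw [← h.e1, h.e2]) (by rw [← h.e4, h.e3]) hT
      h.main.1 ?_ (by rw [h.A_w1, h.e1]) (by rw [h.A_w2, h.e3])
    intro x y hxy
    obtain ⟨X, hX⟩ := hxy.cut
    by_cases hw : w1 ∈ X
    · exact h.ng hg hX.compl (fun k => k hw)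
    · exact h.ng hg hX hw
  apply dec_of_nc
  rw [← dec_nc h1, h.main.2.1]

/-- Inductive reducibility outside of `Z`. -/
inductive Red (Z : Set α) : (Fin 3 → Perm α) → Prop
  | base (τ : Fin 3 → Perm α) (h : ∀ w, w ∉ Z → ∀ a b, τ a w = τ b w)
      (h' : ∀ x ∈ Z, ∀ y ∈ Z, K τ x y) : Red Z τ
  | two (τ : Fin 3 → Perm α) (a b c : Fin 3) (hab : a ≠ b) (hac : a ≠ c) (hbc : b ≠ c) (w : α)
      (h : τ a w = τ b w) (h' : Red Z (fl τ c w (τ a w))) : Red Z τ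
  | four (τ : Fin 3 → Perm α) (a b c : Fin 3) (hab : a ≠ b) (hac : a ≠ c) (hbc : b ≠ c)
      (w1 w2 : α) (hw : w1 ≠ w2) (h1 : τ a w1 = τ b w2) (h2 : τ b w1 = τ a w2)
      (hA : Red Z (AR τ a b c w1 w2)) (hB : Red Z (AR τ b a c w1 w2)) : Red Z τ

theorem same_of_eq {p : Perm α} {x y : α} (h : p y = x) : p.SameCycle x y := by
  have := perm_rel p y
  rwa [h] at this

theorem Red.TT {Z : Set α} {τ : Fin 3 → Perm α} (h : Red Z τ) : TT τ := by
  induction h with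
  | base τ h h' =>
    intro σ hm hg
    have hs : ∀ w, w ∉ Z → σ w = τ 0 w := by
      intro w hw
      by_contra hne
      have h1 : ∀ c, ((τ c)⁻¹ * σ).SameCycle w (σ⁻¹ (τ 0 w)) := by
        intro c
        apply same_of_eq
        rw [Perm.mul_apply, app_inv, h w hw 0 c, inv_app]
      refine hg _ _ (good_of_two hm (a := 0) (b := 1) (c := 2) (by decide) (by decide) (by decide)
        ?_ (h1 0) (h1 1))
      intro e
      apply hne
      conv_lhs => rw [e]
      simp
    refine dec_of_rel 0 fun y => ?_
    by_cases hy : y ∈ Z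
    · by_cases hz : (τ 0)⁻¹ (σ y) ∈ Z
      · exact h' _ hz _ hy
      · have := hs _ hz
        rw [app_inv] at this
        rw [σ.injective this]
    · rw [hs y hy, inv_app]
  | two τ a b c hab hac hbc w h h' ih =>
    intro σ hm hg
    have hs : σ w = τ a w := by
      by_contra hne
      refine hg w (σ⁻¹ (τ a w)) (good_of_two hm hab hac hbc ?_ (same_of_eq ?_) (same_of_eq ?_))
      · intro e
        apply hne
        conv_lhs => rw [e]
        simp
      · rw [Perm.mul_apply, app_inv, inv_app]
      · rw [Perm.mul_apply, app_inv, h, inv_app]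
    obtain ⟨x, R⟩ := Rd.step (τ := τ) (d := a) (P := fun σ => σ w = τ a w) hac hab hbc.symm hac
      (w := w) rfl (fun σ h => h)
    refine R.TT ih ?_ hs hm hg
    intro σ' hD
    apply triv_dec _ hD
    intro d
    rcases all3 hab hac hbc d with rfl | rfl | rfl
    · rw [fl_ne _ hac]
    · rw [fl_ne _ hbc, h]
    · rw [fl_w]
  | four τ a b c hab hac hbc w1 w2 hw h1 h2 hA hB ihA ihB =>
    intro σ hm hg
    obtain ⟨u1, hu1⟩ := σ.surjective (τ a w1)
    obtain ⟨u2, hu2⟩ := σ.surjective (τ a w2)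
    have sa1 : ((τ a)⁻¹ * σ).SameCycle w1 u1 := same_of_eq (by simp [hu1])
    have sa2 : ((τ a)⁻¹ * σ).SameCycle w2 u2 := same_of_eq (by simp [hu2])
    have sb1 : ((τ b)⁻¹ * σ).SameCycle w2 u1 := same_of_eq (by simp [hu1, h1])
    have sb2 : ((τ b)⁻¹ * σ).SameCycle w1 u2 := same_of_eq (by simp [hu2, ← h2])
    have hu : u1 ≠ u2 := by
      rintro rfl
      exact hw ((τ a).injective (hu1.symm.trans hu2))
    have gab : ∀ {w u}, ((τ a)⁻¹ * σ).SameCycle w u → ((τ b)⁻¹ * σ).SameCycle w u → w = u := by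
      intro w u ha hb
      by_contra hne
      exact hg _ _ (good_of_two hm hab hac hbc hne ha hb)
    by_cases k1 : w1 = u1 ∨ w2 = u2
    · have k2 : w1 = u1 ∧ w2 = u2 := by
        rcases k1 with k | k
        · refine ⟨k, gab sa2 ?_⟩
          rw [k] at sb2
          exact sb1.trans sb2
        · refine ⟨gab sa1 ?_, k⟩
          rw [k] at sb1
          exact sb2.trans sb1.symm.symm
      obtain ⟨rfl, rfl⟩ := k2
      exact stepA hab hac hbc hw h1 h2 ihA hm hg hu1 hu2
    by_cases k2 : w1 = u2 ∨ w2 = u1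
    · have k2 : w1 = u2 ∧ w2 = u1 := by
        rcases k2 with k | k
        · refine ⟨k, gab ?_ sb1⟩
          rw [k] at sa1
          exact sa2.trans sa1
        · refine ⟨gab ?_ sb2, k⟩
          rw [k] at sa2
          exact sa1.trans sa2
      obtain ⟨rfl, rfl⟩ := k2
      exact stepA hab.symm hbc hac hw h2 h1 ihB hm hg (by rw [hu2, h2]) (by rw [hu1, h1])
    push Not at k1 k2
    refine Fr.dec (u1 := u1) (u2 := u2) ⟨hab, hac, hbc, hm, hu1, hu1.trans h1, hu2,
      hu2.trans h2.symm, hw, hu, k1.1, k2.1, k2.2, k1.2, ?_, ?_, ?_, ?_⟩ hg ihA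
    · intro k; exact hg _ _ (good_of_two hm hac hab hbc.symm k1.1 sa1 k)
    · intro k; exact hg _ _ (good_of_two hm hbc hab.symm hac.symm k2.1 sb2 k)
    · intro k; exact hg _ _ (good_of_two hm hbc hab.symm hac.symm k2.2 sb1 k)
    · intro k; exact hg _ _ (good_of_two hm hac hab hbc.symm k1.2 sa2 k)

end Four

open Equiv
set_option linter.unusedSectionVars false

section Planar
variable {α : Type*} [DecidableEq α] [Finite α]

/-- Number of faces with colors `a b`. -/
noncomputable def Nf (τ : Fin 3 → Perm α) (a b : Fin 3) : ℕ := numCycles ((τ a)⁻¹ * τ b)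

theorem Nf_comm (τ : Fin 3 → Perm α) (a b : Fin 3) : Nf τ a b = Nf τ b a := by
  unfold Nf
  rw [← numCycles_inv]; congr 1

/-- Total number of faces. -/
noncomputable def FF (τ : Fin 3 → Perm α) : ℕ := Nf τ 0 1 + Nf τ 0 2 + Nf τ 1 2

theorem FF_eq (τ : Fin 3 → Perm α) {a b c : Fin 3} (hab : a ≠ b) (hac : a ≠ c) (hbc : b ≠ c) :
    FF τ = Nf τ a b + Nf τ a c + Nf τ b c := by
  unfold FF
  have h1 := Nf_comm τ 0 1
  have h2 := Nf_comm τ 0 2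
  have h3 := Nf_comm τ 1 2
  fin_cases a <;> fin_cases b <;> fin_cases c <;> simp_all <;> omega

theorem face_le_K (τ : Fin 3 → Perm α) (a b : Fin 3) : permSetoid ((τ a)⁻¹ * τ b) ≤ K τ :=
  permSetoid_le.2 fun y => K_rel (a := a) (b := b) (by rw [Perm.mul_apply, app_inv])

theorem fl_self {τ : Fin 3 → Perm α} {c : Fin 3} {w b : α} (h : τ c w = b) : fl τ c w b = τ := by
  have : (τ c)⁻¹ b = w := by rw [← h, inv_app]
  have e : (swap w w : Perm α) = 1 := swap_self w
  unfold fl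
  rw [this, e, mul_one, Function.update_eq_self]

theorem third {a c : Fin 3} (h : a ≠ c) : ∃ e, a ≠ e ∧ c ≠ e := by
  decide +revert

theorem mono_fl {τ : Fin 3 → Perm α} {a c : Fin 3} (hac : a ≠ c) (w : α) :
    FF τ + 2 * nc (K (fl τ c w (τ a w))) ≤ FF (fl τ c w (τ a w)) + 2 * nc (K τ) := by
  obtain ⟨e, hae, hce⟩ := third hac
  by_cases hw : τ c w = τ a w
  · rw [fl_self hw]
  set v := (τ c)⁻¹ (τ a w) with hv
  have hwv : w ≠ v := by
    intro k; apply hw; rw [k, hv, app_inv, ← hv, ← k]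
  rw [FF_eq τ hae hac hce.symm, FF_eq (fl τ c w (τ a w)) hae hac hce.symm]
  have e1 : Nf (fl τ c w (τ a w)) a e = Nf τ a e := by
    unfold Nf; rw [fl_ne _ hac, fl_ne _ hce.symm]
  have e2 : Nf (fl τ c w (τ a w)) a c = Nf τ a c + 1 := by
    unfold Nf; rw [fl_ne _ hac, fl_c, ← mul_assoc]
    apply numCycles_swap_same hwv
    apply same_of_eq
    rw [Perm.mul_apply, hv, app_inv, inv_app]
  have hK := K_fl (τ := τ) (a := a) (c := c) (w := w) rfl
  rw [← hv] at hK
  by_cases hs : ((τ e)⁻¹ * τ c).SameCycle w v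
  · have e3 : Nf (fl τ c w (τ a w)) e c = Nf τ e c + 1 := by
      unfold Nf; rw [fl_ne _ hce.symm, fl_c, ← mul_assoc]
      exact numCycles_swap_same hwv hs
    have := nc_le_jn (K (fl τ c w (τ a w))) w v
    rw [← hK] at this
    omega
  · have e3 : Nf (fl τ c w (τ a w)) e c + 1 = Nf τ e c := by
      unfold Nf; rw [fl_ne _ hce.symm, fl_c, ← mul_assoc]
      exact numCycles_swap_not_same hs
    have h1 := same_of_not_same hs
    have h2 : K (fl τ c w (τ a w)) w v := by
      apply face_le_K _ e c
      rw [fl_ne _ hce.symm, fl_c, ← mul_assoc]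
      exact h1
    rw [jn_eq h2] at hK
    rw [← hK]
    omega

/-- Trivial white vertices. -/
def Tv (τ : Fin 3 → Perm α) (x : α) : Prop := ∀ a b, τ a x = τ b x

theorem K_triv {τ : Fin 3 → Perm α} {w x : α} (ht : Tv τ w) (h : K τ x w) : x = w := by
  let r : Setoid α := ⟨fun x y => (x = w ↔ y = w),
    ⟨fun _ => Iff.rfl, fun h => h.symm, fun h h' => h.trans h'⟩⟩
  have hr : K τ ≤ r := by
    apply K_le
    intro a c x y e
    constructor
    · rintro rfl
      rw [ht a c] at e
      exact ((τ c).injective e).symm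
    · rintro rfl
      rw [ht c a] at e
      exact (τ a).injective e
  exact (hr h).2 rfl

theorem Tv.fl {τ : Fin 3 → Perm α} {x : α} (h : Tv τ x) (a c : Fin 3) (w : α) :
    Tv (fl τ c w (τ a w)) x := by
  by_cases hx : x = w
  · subst hx
    rw [fl_self (h c a)]; exact h
  · have key : ∀ d, _root_.fl τ c w (τ a w) d x = τ d x := by
      intro d
      rcases eq_or_ne d c with rfl | hd
      · refine fl_other _ _ hx ?_
        rw [h d a]
        exact fun e => hx ((τ a).injective e)
      · rw [fl_ne _ hd]
    intro d d'
    rw [key, key]; exact h d d'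

theorem AR_w1 {τ : Fin 3 → Perm α} {a b c : Fin 3} (hab : a ≠ b) (hac : a ≠ c)
    (hbc : b ≠ c) {w1 w2 : α} (hw : w1 ≠ w2) : Tv (AR τ a b c w1 w2) w1 := by
  have hb : τ a w1 ≠ τ a w2 := fun e => hw ((τ a).injective e)
  have key : ∀ d, AR τ a b c w1 w2 d w1 = τ a w1 := by
    intro d
    rcases all3 hab hac hbc d with rfl | rfl | rfl
    · simp [AR, fl_ne _ hab, fl_ne _ hac]
    · simp [AR, fl_w]
    · rw [AR, fl_ne _ hbc.symm, fl_other _ _ hw, fl_w]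
      rw [fl_w]; exact hb
  intro d d'
  rw [key, key]

theorem AR_eq {τ : Fin 3 → Perm α} {a b c : Fin 3} (hac : a ≠ c) (w1 w2 : α) :
    ∃ τ1 τ2, τ1 = fl τ c w1 (τ a w1) ∧ τ2 = fl τ1 c w2 (τ1 a w2) ∧
      AR τ a b c w1 w2 = fl τ2 b w1 (τ2 a w1) := by
  refine ⟨_, _, rfl, rfl, ?_⟩
  rw [AR, fl_ne _ hac, fl_ne _ hac, fl_ne _ hac]

theorem Tv.AR {τ : Fin 3 → Perm α} {a b c : Fin 3} (hac : a ≠ c) (w1 w2 : α) {x : α}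
    (h : Tv τ x) : Tv (AR τ a b c w1 w2) x := by
  obtain ⟨τ1, τ2, e1, e2, e3⟩ := AR_eq (τ := τ) (b := b) hac w1 w2
  rw [e3]; apply Tv.fl; rw [e2]; apply Tv.fl; rw [e1]; exact h.fl a c w1

theorem mono_AR {τ : Fin 3 → Perm α} {a b c : Fin 3} (hac : a ≠ c) (hab : a ≠ b) (w1 w2 : α) :
    FF τ + 2 * nc (K (AR τ a b c w1 w2)) ≤ FF (AR τ a b c w1 w2) + 2 * nc (K τ) := by
  obtain ⟨τ1, τ2, e1, e2, e3⟩ := AR_eq (τ := τ) (b := b) hac w1 w2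
  have h1 := mono_fl (τ := τ) hac w1
  have h2 := mono_fl (τ := τ1) hac w2
  have h3 := mono_fl (τ := τ2) hab w1
  rw [e3]
  rw [← e1] at h1
  rw [← e2] at h2
  omega

/-- Comparison data. -/
structure Dt (Z BZ : Set α) (τ0 ρ τ : Fin 3 → Perm α) : Prop where
  z1 : ∀ x ∈ Z, Tv ρ x
  z2 : ∀ x, x ∉ Z → ∀ a, τ a x = ρ a x
  z3 : ∀ x ∈ Z, ∀ a, τ a x = τ0 a x
  z4 : ∀ x ∈ Z, ∀ y ∈ Z, K τ0 x y
  b1 : ∀ a x, ρ a x ∈ BZ ↔ x ∈ Z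
  b2 : ∀ a x, τ a x ∈ BZ ↔ x ∈ Z
  b3 : ∀ a x, τ0 a x ∈ BZ ↔ x ∈ Z

theorem Dt.fl_aux {Z BZ : Set α} {τ : Fin 3 → Perm α} (hb : ∀ a x, τ a x ∈ BZ ↔ x ∈ Z)
    {w : α} (hw : w ∉ Z) (a c : Fin 3) {x : α} (hx : x ∈ Z) (d : Fin 3) :
    fl τ c w (τ a w) d x = τ d x := by
  rcases eq_or_ne d c with rfl | hd
  · apply fl_other
    · rintro rfl; exact hw hx
    · intro e
      have := (hb d x).2 hx
      rw [e, hb] at this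
      exact hw this
  · rw [fl_ne _ hd]

theorem Dt.fl_b {Z BZ : Set α} {τ : Fin 3 → Perm α} (hb : ∀ a x, τ a x ∈ BZ ↔ x ∈ Z)
    {w : α} (hw : w ∉ Z) (a c : Fin 3) (d : Fin 3) (x : α) :
    fl τ c w (τ a w) d x ∈ BZ ↔ x ∈ Z := by
  rcases eq_or_ne d c with rfl | hd
  · by_cases h1 : x = w
    · rw [h1, fl_w, hb]
    by_cases h2 : τ d x = τ a w
    · have h3 := _root_.fl_b τ d w (τ a w)
      rw [← h2, inv_app, h2] at h3
      rw [h3, hb]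
      have h4 : x ∉ Z := by
        rw [← hb d x, h2, hb]; exact hw
      exact ⟨fun k => absurd k hw, fun k => absurd k h4⟩
    rw [fl_other _ _ h1 h2, hb]
  · rw [fl_ne _ hd, hb]

theorem Dt.fl {Z BZ : Set α} {τ0 ρ τ : Fin 3 → Perm α} (h : Dt Z BZ τ0 ρ τ) {w : α} (hw : w ∉ Z)
    (a c : Fin 3) : Dt Z BZ τ0 (fl ρ c w (ρ a w)) (fl τ c w (τ a w)) where
  z1 x hx := (h.z1 x hx).fl a c w
  z2 x hx d := by
    rcases eq_or_ne d c with rfl | hd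
    · by_cases h1 : x = w
      · rw [h1, fl_w, fl_w, h.z2 w hw]
      by_cases h2 : τ d x = τ a w
      · have h2' : ρ d x = ρ a w := by rw [← h.z2 x hx, h2, h.z2 w hw]
        have h3 := _root_.fl_b τ d w (τ a w)
        have h3' := _root_.fl_b ρ d w (ρ a w)
        rw [← h2, inv_app, h2] at h3
        rw [← h2', inv_app, h2'] at h3'
        rw [h3, h3', h.z2 w hw]
      have h2' : ρ d x ≠ ρ a w := by rwa [← h.z2 x hx, ← h.z2 w hw]
      rw [fl_other _ _ h1 h2, fl_other _ _ h1 h2', h.z2 x hx]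
    · rw [fl_ne _ hd, fl_ne _ hd, h.z2 x hx]
  z3 x hx d := by rw [fl_aux h.b2 hw a c hx, h.z3 x hx]
  z4 := h.z4
  b1 := fl_b h.b1 hw a c
  b2 := fl_b h.b2 hw a c
  b3 := h.b3

theorem Dt.AR {Z BZ : Set α} {τ0 ρ τ : Fin 3 → Perm α} (h : Dt Z BZ τ0 ρ τ) {w1 w2 : α}
    (hw1 : w1 ∉ Z) (hw2 : w2 ∉ Z) {a b c : Fin 3} (hac : a ≠ c) :
    Dt Z BZ τ0 (AR ρ a b c w1 w2) (AR τ a b c w1 w2) := by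
  obtain ⟨τ1, τ2, e1, e2, e3⟩ := AR_eq (τ := τ) (b := b) hac w1 w2
  obtain ⟨ρ1, ρ2, f1, f2, f3⟩ := AR_eq (τ := ρ) (b := b) hac w1 w2
  rw [e3, f3]
  apply Dt.fl _ hw1
  rw [e2, f2]
  apply Dt.fl _ hw2
  rw [e1, f1]
  exact h.fl hw1 a c

theorem Dt.base {Z BZ : Set α} {τ0 ρ τ : Fin 3 → Perm α} (h : Dt Z BZ τ0 ρ τ)
    (ht : ∀ x, Tv ρ x) : Red Z τ := by
  apply Red.base
  · intro w hw a b
    rw [h.z2 w hw, h.z2 w hw]; exact ht w a b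
  · intro x hx y hy
    let r : Setoid α := ⟨fun x y => (x ∈ Z ∧ y ∈ Z ∧ K τ x y) ∨ (x ∉ Z ∧ y ∉ Z), by
      refine ⟨?_, ?_, ?_⟩
      · intro x
        by_cases k : x ∈ Z
        · exact Or.inl ⟨k, k, (K τ).refl x⟩
        · exact Or.inr ⟨k, k⟩
      · rintro x y (⟨k1, k2, k3⟩ | ⟨k1, k2⟩)
        · exact Or.inl ⟨k2, k1, (K τ).symm k3⟩
        · exact Or.inr ⟨k2, k1⟩
      · rintro x y z (⟨k1, k2, k3⟩ | ⟨k1, k2⟩) (⟨j1, j2, j3⟩ | ⟨j1, j2⟩)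
        · exact Or.inl ⟨k1, j2, (K τ).trans k3 j3⟩
        · exact absurd k2 j1
        · exact absurd j1 k2
        · exact Or.inr ⟨k1, j2⟩⟩
    have hr : K τ0 ≤ r := by
      apply K_le
      intro a b x y e
      have e' : x ∈ Z ↔ y ∈ Z := by rw [← h.b3 a x, e, h.b3]
      by_cases k : x ∈ Z
      · refine Or.inl ⟨k, e'.1 k, K_rel (a := a) (b := b) ?_⟩
        rw [h.z3 x k, h.z3 y (e'.1 k), e]
      · exact Or.inr ⟨k, fun j => k (e'.2 j)⟩
    rcases hr (h.z4 x hx y hy) with k | k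
    · exact k.2.2
    · exact absurd hx k.1

theorem three_le {p : Perm α} {T : α → Prop} (h1 : ∀ x, ¬ T x → p x ≠ x)
    (h2 : ∀ x, ¬ T x → p (p x) ≠ x) : 3 * numCycles p ≤ Nat.card α + 2 * Nat.card {x // T x} := by
  classical
  have key : Nat.card (Quotient (permSetoid p) × Fin 3) ≤
      Nat.card (α ⊕ ({x // T x} ⊕ {x // T x})) := by
    let f : Quotient (permSetoid p) × Fin 3 → α ⊕ ({x // T x} ⊕ {x // T x}) := fun q =>
      if h : T q.1.out then
        (if q.2 = 0 then Sum.inl q.1.out else if q.2 = 1 then Sum.inr (Sum.inl ⟨_, h⟩)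
          else Sum.inr (Sum.inr ⟨_, h⟩))
      else Sum.inl ((p ^ (q.2 : ℕ)) q.1.out)
    let g : α ⊕ ({x // T x} ⊕ {x // T x}) → Quotient (permSetoid p) := fun s =>
      match s with
      | Sum.inl x => Quotient.mk _ x
      | Sum.inr (Sum.inl x) => Quotient.mk _ x.1
      | Sum.inr (Sum.inr x) => Quotient.mk _ x.1
    have hgf : ∀ q, g (f q) = q.1 := by
      rintro ⟨q, i⟩
      simp only [f]
      split_ifs
      · exact Quotient.out_eq q
      · exact Quotient.out_eq q
      · exact Quotient.out_eq q
      · refine Eq.trans ?_ (Quotient.out_eq q)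
        apply Quotient.sound
        exact (permSetoid p).symm ⟨(i : ℕ), by rw [zpow_natCast]⟩
    apply Nat.card_le_card_of_injective f
    rintro ⟨q, i⟩ ⟨q', i'⟩ e
    have e' : q = q' := by
      have := congrArg g e
      rwa [hgf, hgf] at this
    subst e'
    congr 1
    simp only [f] at e
    by_cases hT : T q.out
    · simp only [hT, dite_true] at e
      fin_cases i <;> fin_cases i' <;> simp at e ⊢
    · simp only [hT, dite_false, Sum.inl.injEq] at e
      have a1 := h1 _ hT
      have a2 := h2 _ hT
      have a3 : p (p q.out) ≠ p q.out := fun k => a1 (p.injective k)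
      fin_cases i <;> fin_cases i' <;> simp [pow_two] at e ⊢ <;>
        first
          | exact a1 e | exact a1 e.symm | exact a2 e | exact a2 e.symm
          | exact a3 e | exact a3 e.symm
  rw [Nat.card_prod, Nat.card_sum, Nat.card_sum] at key
  have h3 : Nat.card (Fin 3) = 3 := by simp
  rw [h3] at key
  unfold numCycles
  omega

theorem triv_nc {τ : Fin 3 → Perm α} {w : α} (hw : ¬ Tv τ w) :
    Nat.card {x // Tv τ x} + 1 ≤ nc (K τ) := by
  rw [← Finite.card_option]
  let f : Option {x // Tv τ x} → Quotient (K τ) := fun o =>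
    match o with
    | none => Quotient.mk _ w
    | some x => Quotient.mk _ x.1
  apply Nat.card_le_card_of_injective f
  rintro (_ | ⟨x, hx⟩) (_ | ⟨y, hy⟩) e
  · rfl
  · have := K_triv hy (Quotient.exact e)
    exact absurd (this ▸ hy) hw
  · have := K_triv hx (Quotient.exact e.symm)
    exact absurd (this ▸ hx) hw
  · have := K_triv hy (Quotient.exact e)
    subst this; rfl

theorem short_face {τ : Fin 3 → Perm α} (hP : Nat.card α + 2 * nc (K τ) ≤ FF τ) {w : α}
    (hw : ¬ Tv τ w) :
    ∃ a b c : Fin 3, a ≠ b ∧ a ≠ c ∧ b ≠ c ∧ ∃ x, ¬ Tv τ x ∧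
      (τ a x = τ b x ∨ ∃ y, x ≠ y ∧ ¬ Tv τ y ∧ τ a x = τ b y ∧ τ b x = τ a y) := by
  by_contra hcon
  push Not at hcon
  have key : ∀ a b c : Fin 3, a ≠ b → a ≠ c → b ≠ c →
      3 * Nf τ a b ≤ Nat.card α + 2 * Nat.card {x // Tv τ x} := by
    intro a b c hab hac hbc
    have h1 : ∀ x, ¬ Tv τ x → ((τ a)⁻¹ * τ b) x ≠ x := by
      intro x hx e
      apply (hcon a b c hab hac hbc x hx).1
      rw [Perm.mul_apply] at e
      conv_lhs => rw [← e, app_inv]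
    apply three_le h1
    intro x hx e
    set y := ((τ a)⁻¹ * τ b) x with hy
    have e1 : τ a y = τ b x := by rw [hy, Perm.mul_apply, app_inv]
    have e2 : τ a x = τ b y := by rw [← e, Perm.mul_apply, app_inv]
    have hxy : x ≠ y := (h1 x hx).symm
    refine (hcon a b c hab hac hbc x hx).2 y hxy ?_ e2 e1.symm
    intro hT
    apply hxy
    apply (τ a).injective
    rw [e2, hT b a]
  have k1 := key 0 1 2 (by decide) (by decide) (by decide)
  have k2 := key 0 2 1 (by decide) (by decide) (by decide)
  have k3 := key 1 2 0 (by decide) (by decide) (by decide)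
  have k4 := triv_nc hw
  unfold FF at hP
  omega

theorem red_of_planar {Z BZ : Set α} {τ0 : Fin 3 → Perm α} : ∀ (N : ℕ) (ρ τ : Fin 3 → Perm α),
    {x | ¬ Tv ρ x}.ncard = N → Dt Z BZ τ0 ρ τ → Nat.card α + 2 * nc (K ρ) ≤ FF ρ → Red Z τ := by
  intro N
  induction N using Nat.strong_induction_on with | _ N ih =>
  intro ρ τ hN hD hP
  by_cases hall : ∀ x, Tv ρ x
  · exact hD.base hall
  push Not at hall
  obtain ⟨w, hw⟩ := hall
  have hlt : ∀ (ρ' : Fin 3 → Perm α) (x : α), (∀ y, Tv ρ y → Tv ρ' y) → ¬ Tv ρ x → Tv ρ' x →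
      {x | ¬ Tv ρ' x}.ncard < N := by
    intro ρ' x h1 h2 h3
    rw [← hN]
    apply Set.ncard_lt_ncard _ (Set.toFinite _)
    refine ⟨fun y hy k => hy (h1 y k), fun hsub => ?_⟩
    exact hsub (a := x) h2 h3
  obtain ⟨a, b, c, hab, hac, hbc, x, hx, h | ⟨y, hxy, hy, e1, e2⟩⟩ := short_face hP hw
  · have hxZ : x ∉ Z := fun k => hx (hD.z1 x k)
    refine Red.two τ a b c hab hac hbc x (by rw [hD.z2 x hxZ, hD.z2 x hxZ, h]) ?_
    refine ih _ (hlt (fl ρ c x (ρ a x)) x (fun y hy => hy.fl a c x) hx ?_) _ _ rfl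
      (hD.fl hxZ a c) ?_
    · have key : ∀ d, fl ρ c x (ρ a x) d x = ρ a x := by
        intro d
        rcases all3 hab hac hbc d with rfl | rfl | rfl
        · rw [fl_ne _ hac]
        · rw [fl_ne _ hbc, h]
        · rw [fl_w]
      intro d d'
      rw [key, key]
    · have := mono_fl (τ := ρ) hac x
      omega
  · have hxZ : x ∉ Z := fun k => hx (hD.z1 x k)
    have hyZ : y ∉ Z := fun k => hy (hD.z1 y k)
    refine Red.four τ a b c hab hac hbc x y hxy (by rw [hD.z2 x hxZ, hD.z2 y hyZ, e1])
      (by rw [hD.z2 x hxZ, hD.z2 y hyZ, e2]) ?_ ?_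
    · refine ih _ (hlt _ x (fun z hz => hz.AR hac x y) hx (AR_w1 hab hac hbc hxy)) _ _ rfl
        (hD.AR hxZ hyZ hac) ?_
      have := mono_AR (τ := ρ) hac hab x y
      omega
    · refine ih _ (hlt _ x (fun z hz => hz.AR hbc x y) hx (AR_w1 hab.symm hbc hac hxy)) _ _ rfl
        (hD.AR hxZ hyZ hbc) ?_
      have := mono_AR (τ := ρ) hbc hab.symm x y
      omega

end Planar

open Equiv
set_option linter.unusedSectionVars false

section Bubbles

theorem K_iff_closure {α ι : Type*} (ρ : ι → Perm α) (x y : α) :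
    K ρ x y ↔ ∃ g ∈ Subgroup.closure {g : Perm α | ∃ a b : ι, g = (ρ a)⁻¹ * ρ b}, g x = y := by
  constructor
  · intro h
    induction h with
    | rel x y h =>
      obtain ⟨a, b, e⟩ := h
      refine ⟨(ρ b)⁻¹ * ρ a, Subgroup.subset_closure ⟨b, a, rfl⟩, ?_⟩
      rw [Perm.mul_apply, e]
      exact (ρ b).symm_apply_apply y
    | refl x => exact ⟨1, one_mem _, rfl⟩
    | symm x y _ ih =>
      obtain ⟨g, hg, rfl⟩ := ih
      exact ⟨g⁻¹, inv_mem hg, g.symm_apply_apply x⟩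
    | trans x y z _ _ ih1 ih2 =>
      obtain ⟨g, hg, rfl⟩ := ih1
      obtain ⟨g', hg', rfl⟩ := ih2
      exact ⟨g' * g, mul_mem hg' hg, rfl⟩
  · rintro ⟨g, hg, rfl⟩
    induction hg using Subgroup.closure_induction generalizing x with
    | mem g hg =>
      obtain ⟨a, b, rfl⟩ := hg
      refine K_rel (a := b) (b := a) ?_
      exact ((ρ a).apply_symm_apply _).symm
    | one => exact (K ρ).refl _
    | mul g g' _ _ ih ih' => exact (K ρ).trans (ih' x) (ih (g' x))
    | inv g _ ih =>
      have := ih (g⁻¹ x)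
      have e : g (g⁻¹ x) = x := g.apply_symm_apply x
      rw [e] at this
      exact (K ρ).symm this

variable {n m : ℕ}

/-- The family `W` lists the bubbles. -/
structure Bub (τ : Fin 3 → Perm (Fin n)) (W : Fin (m + 1) → Set (Fin n)) : Prop where
  iff : ∀ j x y, x ∈ W j → (y ∈ W j ↔ K τ x y)
  ne : ∀ j, ∃ x, x ∈ W j
  disj : ∀ i j x, x ∈ W i → x ∈ W j → i = j
  cov : ∀ x, ∃ j, x ∈ W j

theorem bub_of {τ : Fin 3 → Perm (Fin n)} {W : Fin (m + 1) → Set (Fin n)}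
    (horb : ∀ j, ∃ w : Fin n, W j = MulAction.orbit (bubbleSubgroup τ) w)
    (hinj : Function.Injective W)
    (hcover : ∀ x : Fin n, ∃ j, x ∈ W j) : Bub τ W := by
  have h0 : ∀ w y, y ∈ MulAction.orbit (bubbleSubgroup τ) w ↔ K τ w y := by
    intro w y
    rw [K_iff_closure]
    constructor
    · rintro ⟨⟨g, hg⟩, rfl⟩
      exact ⟨g, hg, rfl⟩
    · rintro ⟨g, hg, rfl⟩
      exact ⟨⟨g, hg⟩, rfl⟩
  have h1 : ∀ j x y, x ∈ W j → (y ∈ W j ↔ K τ x y) := by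
    intro j x y hx
    obtain ⟨w, hw⟩ := horb j
    rw [hw, h0] at hx
    rw [hw, h0]
    exact ⟨fun k => (K τ).trans ((K τ).symm hx) k, fun k => (K τ).trans hx k⟩
  refine ⟨h1, ?_, ?_, hcover⟩
  · intro j
    obtain ⟨w, hw⟩ := horb j
    exact ⟨w, by rw [hw, h0]⟩
  · intro i j x hi hj
    apply hinj
    ext y
    rw [h1 i x y hi, h1 j x y hj]

variable {τ : Fin 3 → Perm (Fin n)} {W : Fin (m + 1) → Set (Fin n)}

open Classical in
/-- Replace the bubble `Z` by trivial whites. -/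
noncomputable def rhoF (τ : Fin 3 → Perm (Fin n)) (Z : Set (Fin n)) (a : Fin 3) (x : Fin n) :
    Fin n := if x ∈ Z then τ 0 x else τ a x

theorem rhoF_inj {Z : Set (Fin n)} (hZ : ∀ x y, K τ x y → (x ∈ Z ↔ y ∈ Z)) (a : Fin 3) :
    Function.Injective (rhoF τ Z a) := by
  intro x y e
  unfold rhoF at e
  split_ifs at e with h1 h2 h2
  · exact (τ 0).injective e
  · exact absurd ((hZ x y (K_rel e)).1 h1) h2
  · exact absurd ((hZ x y (K_rel e)).2 h2) h1
  · exact (τ a).injective e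

/-- Replace the bubble `Z` by trivial whites. -/
noncomputable def rho {Z : Set (Fin n)} (hZ : ∀ x y, K τ x y → (x ∈ Z ↔ y ∈ Z)) (a : Fin 3) :
    Perm (Fin n) := Equiv.ofBijective _ (Finite.injective_iff_bijective.1 (rhoF_inj hZ a))

variable {Z : Set (Fin n)} (hZ : ∀ x y, K τ x y → (x ∈ Z ↔ y ∈ Z))

theorem rho_in (a : Fin 3) {x : Fin n} (h : x ∈ Z) : rho hZ a x = τ 0 x := by
  change rhoF τ Z a x = _
  unfold rhoF; rw [if_pos h]

theorem rho_out (a : Fin 3) {x : Fin n} (h : x ∉ Z) : rho hZ a x = τ a x := by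
  change rhoF τ Z a x = _
  unfold rhoF; rw [if_neg h]

theorem rho_face (a b : Fin 3) {x y : Fin n}
    (h : ((rho hZ a)⁻¹ * rho hZ b).SameCycle x y) :
    x = y ∨ (x ∉ Z ∧ y ∉ Z ∧ ((τ a)⁻¹ * τ b).SameCycle x y) := by
  let r : Setoid (Fin n) := ⟨fun x y => x = y ∨ (x ∉ Z ∧ y ∉ Z ∧ ((τ a)⁻¹ * τ b).SameCycle x y), by
    refine ⟨fun x => Or.inl rfl, ?_, ?_⟩
    · rintro x y (rfl | ⟨h1, h2, h3⟩)
      · exact Or.inl rfl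
      · exact Or.inr ⟨h2, h1, h3.symm⟩
    · rintro x y z (rfl | ⟨h1, h2, h3⟩) (rfl | ⟨h1', h2', h3'⟩)
      · exact Or.inl rfl
      · exact Or.inr ⟨h1', h2', h3'⟩
      · exact Or.inr ⟨h1, h2, h3⟩
      · exact Or.inr ⟨h1, h2', h3.trans h3'⟩⟩
  have hr : permSetoid ((rho hZ a)⁻¹ * rho hZ b) ≤ r := by
    rw [permSetoid_le]
    intro y
    by_cases hy : y ∈ Z
    · left
      rw [Perm.mul_apply, rho_in hZ b hy, ← rho_in hZ a hy, inv_app]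
    · right
      have h1 : ((τ a)⁻¹ * τ b) y ∉ Z := by
        rwa [hZ _ y (face_le_K τ a b (perm_rel _ y))]
      have h2 : ((rho hZ a)⁻¹ * rho hZ b) y = ((τ a)⁻¹ * τ b) y := by
        rw [Perm.mul_apply, rho_out hZ b hy, Perm.inv_eq_iff_eq, rho_out hZ a h1,
          Perm.mul_apply, app_inv]
      rw [h2]
      exact ⟨h1, hy, perm_rel _ y⟩
  exact hr h

theorem K_rho {x y : Fin n} (h : K τ x y) (hx : x ∉ Z) : K (rho hZ) x y := by
  let r : Setoid (Fin n) := ⟨fun x y => (x ∈ Z ∧ y ∈ Z) ∨ (x ∉ Z ∧ y ∉ Z ∧ K (rho hZ) x y), by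
      refine ⟨?_, ?_, ?_⟩
      · intro x
        by_cases k : x ∈ Z
        · exact Or.inl ⟨k, k⟩
        · exact Or.inr ⟨k, k, (K _).refl x⟩
      · rintro x y (⟨k1, k2⟩ | ⟨k1, k2, k3⟩)
        · exact Or.inl ⟨k2, k1⟩
        · exact Or.inr ⟨k2, k1, (K _).symm k3⟩
      · rintro x y z (⟨k1, k2⟩ | ⟨k1, k2, k3⟩) (⟨j1, j2⟩ | ⟨j1, j2, j3⟩)
        · exact Or.inl ⟨k1, j2⟩
        · exact absurd k2 j1
        · exact absurd j1 k2
        · exact Or.inr ⟨k1, j2, (K _).trans k3 j3⟩⟩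
  have hr : K τ ≤ r := by
    apply K_le
    intro a b x y e
    have hxy := hZ x y (K_rel e)
    by_cases k : x ∈ Z
    · exact Or.inl ⟨k, hxy.1 k⟩
    · have k' : y ∉ Z := fun j => k (hxy.2 j)
      refine Or.inr ⟨k, k', K_rel (a := a) (b := b) ?_⟩
      rw [rho_out hZ a k, rho_out hZ b k', e]
  rcases hr h with k | k
  · exact absurd k.1 hx
  · exact k.2.2

theorem faces_ge (hW : Bub τ W) (hZ : ∀ x y, K τ x y → (x ∈ W 0 ↔ y ∈ W 0)) (a b : Fin 3) :
    Nat.card (W 0) + ∑ j : {j : Fin (m + 1) // j ≠ 0}, orbitsIn ((τ a)⁻¹ * τ b) (W j) ≤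
      Nf (rho hZ) a b := by
  let p := (τ a)⁻¹ * τ b
  let T : {j : Fin (m + 1) // j ≠ 0} → Type := fun j => {q : Quotient (permSetoid p) //
    ∀ x : Fin n, Quotient.mk (permSetoid p) x = q → x ∈ W j}
  let f : (W 0) ⊕ (Σ j, T j) → Quotient (permSetoid ((rho hZ a)⁻¹ * rho hZ b)) := fun s =>
    match s with
    | Sum.inl z => Quotient.mk _ z.1
    | Sum.inr ⟨_, q⟩ => Quotient.mk _ q.1.out
  have hin : ∀ (j) (q : T j), q.1.out ∈ W j := fun j q => q.2 _ (Quotient.out_eq _)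
  have hf : Function.Injective f := by
    rintro (⟨z, hz⟩ | ⟨j, q⟩) (⟨z', hz'⟩ | ⟨j', q'⟩) e
    · rcases rho_face hZ a b (Quotient.exact e) with k | k
      · congr
      · exact absurd hz k.1
    · exfalso
      rcases rho_face hZ a b (Quotient.exact e) with k | k
      · have := hin j' q'
        rw [← k] at this
        exact j'.2 (hW.disj _ _ _ this hz)
      · exact absurd hz k.1
    · exfalso
      rcases rho_face hZ a b (Quotient.exact e) with k | k
      · have := hin j q
        rw [k] at this
        exact j.2 (hW.disj _ _ _ this hz')
      · exact absurd hz' k.2.1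
    · have h1 : p.SameCycle q.1.out q'.1.out := by
        rcases rho_face hZ a b (Quotient.exact e) with k | k
        · rw [k]
        · exact k.2.2
      have h2 : q.1 = q'.1 := by
        rw [← Quotient.out_eq q.1, ← Quotient.out_eq q'.1]
        exact Quotient.sound h1
      have h3 : j = j' := by
        apply Subtype.ext
        refine hW.disj _ _ q.1.out (hin j q) ?_
        rw [h2]
        exact hin j' q'
      subst h3
      have : q = q' := Subtype.ext h2
      rw [this]
  have := Nat.card_le_card_of_injective f hf
  rw [Nat.card_sum, Nat.card_sigma] at this
  exact this

theorem planar_rho (hW : Bub τ W) (hZ : ∀ x y, K τ x y → (x ∈ W 0 ↔ y ∈ W 0))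
    (hplanar : ∀ j, j ≠ 0 →
      orbitsIn ((τ 0)⁻¹ * τ 1) (W j) + orbitsIn ((τ 0)⁻¹ * τ 2) (W j) +
        orbitsIn ((τ 1)⁻¹ * τ 2) (W j) = (W j).ncard + 2) :
    Nat.card (Fin n) + 2 * nc (K (rho hZ)) ≤ FF (rho hZ) := by
  have f1 := faces_ge hW hZ 0 1
  have f2 := faces_ge hW hZ 0 2
  have f3 := faces_ge hW hZ 1 2
  have hs : ∑ j : {j : Fin (m + 1) // j ≠ 0}, orbitsIn ((τ 0)⁻¹ * τ 1) (W j) +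
      ∑ j : {j : Fin (m + 1) // j ≠ 0}, orbitsIn ((τ 0)⁻¹ * τ 2) (W j) +
      ∑ j : {j : Fin (m + 1) // j ≠ 0}, orbitsIn ((τ 1)⁻¹ * τ 2) (W j) =
      ∑ j : {j : Fin (m + 1) // j ≠ 0}, Nat.card (W j) + 2 * m := by
    rw [← Finset.sum_add_distrib, ← Finset.sum_add_distrib]
    rw [Finset.sum_congr rfl fun j _ => hplanar j.1 j.2]
    rw [Finset.sum_add_distrib, Finset.sum_const, Finset.card_univ]
    have : Fintype.card {j : Fin (m + 1) // j ≠ 0} = m := by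
      simp [Fintype.card_subtype_compl]
    rw [this, smul_eq_mul, mul_comm m 2]
    rfl
  have hn : Nat.card (Fin n) ≤
      Nat.card (W 0) + ∑ j : {j : Fin (m + 1) // j ≠ 0}, Nat.card (W j) := by
    rw [← Nat.card_sigma, ← Nat.card_sum]
    let g : (W 0) ⊕ (Σ j : {j : Fin (m + 1) // j ≠ 0}, W j) → Fin n := fun s =>
      match s with
      | Sum.inl z => z.1
      | Sum.inr ⟨_, q⟩ => q.1
    apply Nat.card_le_card_of_surjective g
    intro x
    obtain ⟨j, hj⟩ := hW.cov x
    by_cases h0 : j = 0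
    · subst h0; exact ⟨Sum.inl ⟨x, hj⟩, rfl⟩
    · exact ⟨Sum.inr ⟨⟨j, h0⟩, ⟨x, hj⟩⟩, rfl⟩
  have hk : nc (K (rho hZ)) ≤ Nat.card (W 0) + m := by
    have hm : Nat.card {j : Fin (m + 1) // j ≠ 0} = m := by
      rw [Nat.card_eq_fintype_card]
      simp [Fintype.card_subtype_compl]
    choose rep hrep using hW.ne
    suffices hh : nc (K (rho hZ)) ≤ Nat.card ((W 0) ⊕ {j : Fin (m + 1) // j ≠ 0}) by
      rwa [Nat.card_sum, hm] at hh
    let g : (W 0) ⊕ {j : Fin (m + 1) // j ≠ 0} → Quotient (K (rho hZ)) := fun s =>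
      match s with
      | Sum.inl z => Quotient.mk _ z.1
      | Sum.inr j => Quotient.mk _ (rep j.1)
    apply Nat.card_le_card_of_surjective g
    intro q
    induction q using Quotient.inductionOn with | _ x =>
    obtain ⟨j, hj⟩ := hW.cov x
    by_cases h0 : j = 0
    · subst h0; exact ⟨Sum.inl ⟨x, hj⟩, rfl⟩
    · refine ⟨Sum.inr ⟨j, h0⟩, Quotient.sound ?_⟩
      apply K_rho hZ ((hW.iff j _ _ (hrep j)).1 hj)
      intro k
      exact h0 (hW.disj _ _ _ (hrep j) k)
  unfold FF
  omega

theorem main_TT (hW : Bub τ W)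
    (hplanar : ∀ j, j ≠ 0 →
      orbitsIn ((τ 0)⁻¹ * τ 1) (W j) + orbitsIn ((τ 0)⁻¹ * τ 2) (W j) +
        orbitsIn ((τ 1)⁻¹ * τ 2) (W j) = (W j).ncard + 2) : TT τ := by
  have hZ : ∀ x y, K τ x y → (x ∈ W 0 ↔ y ∈ W 0) := by
    intro x y h
    exact ⟨fun k => (hW.iff 0 x y k).2 h, fun k => (hW.iff 0 y x k).2 ((K τ).symm h)⟩
  have hB : ∀ a x, τ a x ∈ τ 0 '' W 0 ↔ x ∈ W 0 := by
    intro a x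
    constructor
    · rintro ⟨z, hz, e⟩
      exact (hZ z x (K_rel e)).1 hz
    · intro hx
      refine ⟨(τ 0)⁻¹ (τ a x), (hZ _ x (K_rel (a := 0) (b := a) (app_inv _ _))).2 hx, app_inv _ _⟩
  have hD : Dt (W 0) (τ 0 '' W 0) τ (rho hZ) τ := by
    refine ⟨?_, ?_, fun _ _ _ => rfl, fun x hx y hy => (hW.iff 0 x y hx).1 hy, ?_, hB, hB⟩
    · intro x hx a b
      rw [rho_in hZ a hx, rho_in hZ b hx]
    · intro x hx a
      rw [rho_out hZ a hx]
    · intro a x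
      by_cases hx : x ∈ W 0
      · rw [rho_in hZ a hx, hB]
      · rw [rho_out hZ a hx, hB]
  exact (red_of_planar _ _ _ rfl hD (planar_rho hW hZ hplanar)).TT

end Bubbles

open Equiv
set_option linter.unusedSectionVars false

section Pairing
variable {α : Type*} [DecidableEq α] [Finite α] {τ : Fin 3 → Perm α} {σ : Perm α}

/-- Either `σ` pairs `w` with the black vertex of `v`, or the corresponding edges form a 2-cut. -/
def RR (τ : Fin 3 → Perm α) (σ : Perm α) (w v : α) : Prop :=
  ∃ X : Set α, (∀ s t, K τ s t → (s ∈ X ↔ t ∈ X)) ∧ w ∈ X ∧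
    ∀ t ∈ X, t ≠ w → (τ 0)⁻¹ (σ t) ∈ X ∧ (τ 0)⁻¹ (σ t) ≠ v

theorem RR_self {w v : α} (h : σ w = τ 0 v) : RR τ σ w v := by
  refine ⟨Set.univ, fun _ _ _ => Iff.rfl, trivial, fun t _ ht => ⟨trivial, ?_⟩⟩
  intro e
  rw [Perm.inv_eq_iff_eq, ← h] at e
  exact ht (σ.injective e)

theorem RR_iff {w v : α} (hwv : K τ w v) :
    RR τ σ w v ↔ (σ w = τ 0 v ∨ Good τ σ w (σ⁻¹ (τ 0 v))) := by
  constructor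
  · rintro ⟨X, hX, hw, h⟩
    by_cases e : σ w = τ 0 v
    · exact Or.inl e
    right
    have hv : v ∈ X := (hX _ _ hwv).1 hw
    refine cut_good hX 0 ?_ hw (fun t ht htw => (h t ht htw).1) ?_
    · intro k
      refine (h _ k ?_).2 (by rw [app_inv, inv_app])
      intro e'
      apply e
      rw [← e', app_inv]
    · rwa [app_inv, inv_app]
  · rintro (h | h)
    · exact RR_self h
    · obtain ⟨X, hX⟩ := h.cut
      refine ⟨X, hX.cl, hX.hx, fun t ht htw => ⟨hX.int 0 t ht htw, ?_⟩⟩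
      intro e
      rw [Perm.inv_eq_iff_eq] at e
      apply hX.hy
      rwa [← e, inv_app]

theorem sw_other {w u t : α} (h : t ≠ w) (h' : t ≠ u) : (σ * swap w u) t = σ t := by
  rw [Perm.mul_apply, swap_apply_of_ne_of_ne h h']

theorem sw_left {w u : α} : (σ * swap w u) w = σ u := by
  rw [Perm.mul_apply, swap_apply_left]

theorem sw_right {w u : α} : (σ * swap w u) u = σ w := by
  rw [Perm.mul_apply, swap_apply_right]

theorem RR_mono_aux {w1 u1 w v : α} {X1 : Set α} (hC : Cut τ σ w1 u1 X1) (hwv : K τ w v)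
    (hw : w ∈ X1) (h : RR τ (σ * swap w1 u1) w v) : RR τ σ w v := by
  obtain ⟨X0, hX0, hw0, h0⟩ := h
  have hne : w1 ≠ u1 := fun e => hC.hy (e ▸ hC.hx)
  have hv : v ∈ X1 := (hC.cl _ _ hwv).1 hw
  by_cases hc : w1 ∉ X0 ∨ w1 = w
  · refine ⟨X0 ∩ X1, fun s t k => and_congr (hX0 s t k) (hC.cl s t k), ⟨hw0, hw⟩, ?_⟩
    intro t ht htw
    have e1 : t ≠ w1 := by
      rcases hc with hc | hc
      · rintro rfl; exact hc ht.1
      · rwa [hc]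
    have e2 : t ≠ u1 := fun e => hC.hy (e ▸ ht.2)
    have := h0 t ht.1 htw
    rw [sw_other e1 e2] at this
    exact ⟨⟨this.1, hC.int 0 t ht.2 e1⟩, this.2⟩
  push Not at hc
  refine ⟨X0 ∪ X1ᶜ, fun s t k => or_congr (hX0 s t k) (not_congr (hC.cl s t k)), Or.inl hw0, ?_⟩
  have hout : ∀ {z}, z ∉ X1 → z ∈ X0 ∪ X1ᶜ ∧ z ≠ v :=
    fun {z} hz => ⟨Or.inr hz, fun e => hz (e ▸ hv)⟩
  intro t ht htw
  by_cases e2 : t = u1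
  · have := h0 w1 hc.1 hc.2
    rw [sw_left] at this
    rw [e2]
    exact ⟨Or.inl this.1, this.2⟩
  by_cases e1 : t = w1
  · rw [e1]; exact hout (hC.px 0)
  by_cases k : t ∈ X1
  · have h3 := h0 t (ht.resolve_right (fun j => j k)) htw
    rw [sw_other e1 e2] at h3
    exact ⟨Or.inl h3.1, h3.2⟩
  · exact hout (hC.out 0 t k e2)

theorem RR_mono {w1 u1 w v : α} (hg : Good τ σ w1 u1) (hwv : K τ w v)
    (h : RR τ (σ * swap w1 u1) w v) : RR τ σ w v := by
  obtain ⟨X, hX⟩ := hg.cut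
  by_cases hw : w ∈ X
  · exact RR_mono_aux hX hwv hw h
  · rw [swap_comm] at h
    exact RR_mono_aux hX.compl hwv hw h

theorem RR_persist {w1 u1 v1 w v : α} (hg : Good τ σ w1 u1) (hv1 : (τ 0)⁻¹ (σ u1) = v1)
    (hwv1 : K τ w1 v1) (hww : w ≠ w1) (hvv : v ≠ v1)
    (h : RR τ σ w v) : RR τ (σ * swap w1 u1) w v := by
  obtain ⟨Y, hY⟩ := hg.cut
  obtain ⟨X, hX, hw, h0⟩ := h
  have hx1 := hX _ _ hwv1
  by_cases k : w ∈ Y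
  · refine ⟨X ∩ Y, fun s t k => and_congr (hX s t k) (hY.cl s t k), ⟨hw, k⟩, ?_⟩
    intro t ht htw
    have e2 : t ≠ u1 := fun e => hY.hy (e ▸ ht.2)
    by_cases e1 : t = w1
    · rw [e1, sw_left, hv1]
      rw [e1] at ht
      exact ⟨⟨hx1.1 ht.1, (hY.cl _ _ hwv1).1 ht.2⟩, hvv.symm⟩
    · rw [sw_other e1 e2]
      have := h0 t ht.1 htw
      exact ⟨⟨this.1, hY.int 0 t ht.2 e1⟩, this.2⟩
  · refine ⟨X ∩ Yᶜ, fun s t k => and_congr (hX s t k) (not_congr (hY.cl s t k)), ⟨hw, k⟩, ?_⟩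
    intro t ht htw
    have e1 : t ≠ w1 := fun e => ht.2 (e ▸ hY.hx)
    by_cases e2 : t = u1
    · rw [e2, sw_right]
      rw [e2] at ht htw
      have h1 := h0 _ ht.1 htw
      rw [hv1] at h1
      have h2 := h0 w1 (hx1.2 h1.1) hww.symm
      exact ⟨⟨h2.1, hY.px 0⟩, h2.2⟩
    · rw [sw_other e1 e2]
      have := h0 t ht.1 htw
      exact ⟨⟨this.1, hY.out 0 t ht.2 e2⟩, this.2⟩

theorem nc_le_card (r : Setoid α) : nc r ≤ Nat.card α :=
  Nat.card_le_card_of_surjective (Quotient.mk r) Quotient.mk_surjective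

theorem exists_pairing (hT : TT τ) : ∀ (N : ℕ) (σ : Perm α), Nat.card α - nc (KK τ σ) = N →
    IsMx τ σ → ∃ ρ, Dec τ ρ ∧ IsMx τ ρ ∧ ∀ w, RR τ σ w ((τ 0)⁻¹ (ρ w)) := by
  intro N
  induction N using Nat.strong_induction_on with | _ N ih =>
  intro σ hN hm
  by_cases hg : ∀ w u, ¬ Good τ σ w u
  · exact ⟨σ, hT σ hm hg, hm, fun w => RR_self (by rw [app_inv])⟩
  push Not at hg
  obtain ⟨w, u, hg⟩ := hg
  have h1 := good_nc hg
  have h2 := nc_le_card (KK τ (σ * swap w u))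
  obtain ⟨ρ, hD, hm', hR⟩ := ih _ (by omega) (σ * swap w u) rfl
    (fun σ' => by rw [good_Ph hg]; exact hm σ')
  exact ⟨ρ, hD, hm', fun x => RR_mono hg ((K τ).symm (dec_rel hD 0 x)) (hR x)⟩

theorem Ph_of_pairing {ρ : Perm α} (hD : Dec τ ρ) : ∀ (N : ℕ) (σ : Perm α),
    {w | σ w ≠ ρ w}.ncard = N → (∀ w, RR τ σ w ((τ 0)⁻¹ (ρ w))) → Ph τ σ = Ph τ ρ := by
  intro N
  induction N using Nat.strong_induction_on with | _ N ih =>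
  intro σ hN hR
  by_cases he : ∀ w, σ w = ρ w
  · rw [Equiv.ext he]
  push Not at he
  obtain ⟨w1, hw1⟩ := he
  have hK : ∀ x, K τ x ((τ 0)⁻¹ (ρ x)) := fun x => (K τ).symm (dec_rel hD 0 x)
  have h1 := (RR_iff (hK w1)).1 (hR w1)
  rw [app_inv] at h1
  have hg := h1.resolve_left hw1
  set u1 := σ⁻¹ (ρ w1) with hu1
  have hsu : σ u1 = ρ w1 := by rw [hu1, app_inv]
  have hne := good_ne hg
  rw [← good_Ph hg]
  refine ih _ ?_ _ rfl ?_
  · rw [← hN]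
    apply Set.ncard_lt_ncard _ (Set.toFinite _)
    constructor
    · intro t ht
      simp only [Set.mem_setOf_eq] at ht ⊢
      by_cases e1 : t = w1
      · rw [e1]; exact hw1
      by_cases e2 : t = u1
      · rw [e2, hsu]; exact fun e => hne (ρ.injective e)
      rwa [sw_other e1 e2] at ht
    · intro hsub
      have := hsub (a := w1) hw1
      apply this
      rw [sw_left, hsu]
  · intro w
    by_cases e : w = w1
    · subst e
      apply RR_self
      rw [sw_left, hsu, app_inv]
    · refine RR_persist hg (v1 := (τ 0)⁻¹ (ρ w1)) (by rw [hsu]) (hK w1) e ?_ (hR w)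
      intro eq1
      exact e (ρ.injective ((τ 0)⁻¹.injective eq1))

/-- Connecting without changing the potential. -/
theorem exists_conn : ∀ (N : ℕ) (σ : Perm α), nc (KK τ σ) = N → ∃ ρ, Ph τ ρ = Ph τ σ ∧
    ∀ x y, KK τ ρ x y := by
  intro N
  induction N using Nat.strong_induction_on with | _ N ih =>
  intro σ hN
  by_cases hc : ∀ x y, KK τ σ x y
  · exact ⟨σ, rfl, hc⟩
  push Not at hc
  obtain ⟨x, y, hxy⟩ := hc
  obtain ⟨h1, h2⟩ := join_Ph hxy
  obtain ⟨ρ, h3, h4⟩ := ih _ (by omega) (σ * swap x y) rfl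
  exact ⟨ρ, h3.trans h1, h4⟩

theorem nc_top {r r' : Setoid α} (h : ∀ x y, r x y) (h' : ∀ x y, r' x y) : nc r = nc r' := by
  congr 1
  ext x y
  exact ⟨fun _ => h' x y, fun _ => h x y⟩

theorem Mx_iff_conn (hc : ∀ x y, KK τ σ x y) :
    IsMx τ σ ↔ ∀ ρ, (∀ x y, KK τ ρ x y) → CC τ ρ ≤ CC τ σ := by
  constructor
  · intro h ρ hρ
    have := h ρ
    unfold Ph at this
    rw [nc_top hρ hc] at this
    omega
  · intro h ρ
    obtain ⟨ρ', h1, h2⟩ := exists_conn (τ := τ) _ ρ rfl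
    rw [← h1]
    have := h ρ' h2
    unfold Ph
    rw [nc_top h2 hc]
    omega

end Pairing

open Equiv
set_option linter.unusedSectionVars false

section Final
variable {n m : ℕ} {τ : Fin 3 → Perm (Fin n)} {σ ρ : Perm (Fin n)}
  {W : Fin (m + 1) → Set (Fin n)}

theorem K_withZero : K (withZero σ τ) = KK τ σ := by
  apply le_antisymm
  · apply K_le
    intro a b x y h
    induction a using Fin.cases with
    | zero =>
      induction b using Fin.cases with
      | zero =>
        have : x = y := σ.injective h
        rw [this]
      | succ b => exact (KK τ σ).symm (KK_rel (a := b) h.symm)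
    | succ a =>
      induction b using Fin.cases with
      | zero => exact KK_rel (a := a) h
      | succ b => exact K_le_KK (K_rel (a := a) (b := b) h)
  · refine KK_le 0 (K_le fun a b x y h => K_rel (a := a.succ) (b := b.succ) h) fun y => ?_
    refine K_rel (a := (0 : Fin 3).succ) (b := 0) ?_
    change τ 0 ((τ 0)⁻¹ (σ y)) = σ y
    rw [app_inv]

theorem conn_iff : ColoredConnected (withZero σ τ) ↔ ∀ x y, KK τ σ x y := by
  rw [← K_withZero]
  unfold ColoredConnected
  simp only [K_iff_closure]

theorem C0_eq : C0 (withZero σ τ) = CC τ σ := by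
  unfold C0 CC
  rw [Fin.sum_univ_three]
  rfl

theorem mc_of {E : Set (Fin n × Fin 4)} (hE : ∀ i c, (i, c) ∈ E → c = 0)
    (h : ∀ r : Setoid (Fin n), K τ ≤ r → (∀ t, (t, (0 : Fin 4)) ∉ E → r ((τ 0)⁻¹ (σ t)) t) →
      ∀ x y, r x y) : minusConnected (withZero σ τ) E := by
  let s : Setoid (Fin n ⊕ Fin n) := Relation.EqvGen.setoid
    (fun p q => ∃ (i : Fin n) (c : Fin 4),
        (i, c) ∉ E ∧ p = Sum.inl i ∧ q = Sum.inr (withZero σ τ c i))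
  have hs : ∀ i c, (i, c) ∉ E → s (Sum.inl i) (Sum.inr (withZero σ τ c i)) :=
    fun i c hi => Relation.EqvGen.rel _ _ ⟨i, c, hi, rfl, rfl⟩
  have hs' : ∀ i (a : Fin 3), s (Sum.inl i) (Sum.inr (τ a i)) :=
    fun i a => hs i a.succ fun k => Fin.succ_ne_zero a (hE _ _ k)
  have key := h (s.comap Sum.inl) (K_le fun a b x y e => by
      rw [Setoid.comap_rel]
      refine s.trans (hs' x a) ?_
      rw [e]
      exact s.symm (hs' y b)) (fun t ht => by
      rw [Setoid.comap_rel]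
      refine s.trans (hs' _ 0) ?_
      rw [app_inv]
      exact s.symm (hs t 0 ht))
  have hb : ∀ z : Fin n ⊕ Fin n, ∃ x, s z (Sum.inl x) := by
    rintro (x | β)
    · exact ⟨x, s.refl _⟩
    · refine ⟨(τ 0)⁻¹ β, s.symm ?_⟩
      have := hs' ((τ 0)⁻¹ β) 0
      rwa [app_inv] at this
  intro x y
  obtain ⟨x', hx⟩ := hb x
  obtain ⟨y', hy⟩ := hb y
  exact s.trans hx (s.trans (key x' y') (s.symm hy))

theorem not_mc {E : Set (Fin n × Fin 4)} {X : Set (Fin n)} (hX : ∀ s t, K τ s t → (s ∈ X ↔ t ∈ X))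
    (h : ∀ t, (t, (0 : Fin 4)) ∉ E → ((τ 0)⁻¹ (σ t) ∈ X ↔ t ∈ X))
    (hc : minusConnected (withZero σ τ) E) (x y : Fin n) : x ∈ X ↔ y ∈ X := by
  let f : Fin n ⊕ Fin n → Prop := Sum.elim (fun x => x ∈ X) (fun b => (τ 0)⁻¹ b ∈ X)
  have key : ∀ p q, Relation.EqvGen (fun p q => ∃ (i : Fin n) (c : Fin 4),
        (i, c) ∉ E ∧ p = Sum.inl i ∧ q = Sum.inr (withZero σ τ c i)) p q → (f p ↔ f q) := by
    intro p q hpq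
    induction hpq with
    | rel p q hpq =>
      obtain ⟨i, c, hi, rfl, rfl⟩ := hpq
      change i ∈ X ↔ (τ 0)⁻¹ (withZero σ τ c i) ∈ X
      induction c using Fin.cases with
      | zero => exact (h i hi).symm
      | succ c =>
        apply hX
        refine K_rel (a := c) (b := 0) ?_
        rw [app_inv]
        rfl
    | refl => exact Iff.rfl
    | symm _ _ _ ih => exact ih.symm
    | trans _ _ _ _ _ ih1 ih2 => exact ih1.trans ih2
  exact key _ _ (hc (Sum.inl x) (Sum.inl y))

theorem edgeCut_iff (hc : ∀ x y, KK τ σ x y) {w u : Fin n} (hwu : w ≠ u)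
    (hK : K τ w ((τ 0)⁻¹ (σ u))) :
    IsEdgeCut (withZero σ τ) {(w, 0), (u, 0)} ↔ Good τ σ w u := by
  constructor
  · rintro ⟨h1, -⟩
    by_contra hg
    have hg' : KK τ (σ * swap w u) w u := not_not.1 hg
    have hall : ∀ x y, KK τ (σ * swap w u) x y := by
      intro x y
      have := le_jn (KK τ σ) w u (hc x y)
      rwa [← KK_jn, jn_eq hg'] at this
    apply h1
    apply mc_of
    · rintro i c (h | h) <;> exact (Prod.ext_iff.1 h).2
    intro r hr hr2 x y
    have hne : ∀ t, t ≠ u → r (((τ 0)⁻¹ * (σ * swap w u)) t) t := by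
      intro t ht
      rw [Perm.mul_apply]
      by_cases e : t = w
      · subst e
        rw [sw_left]
        exact r.symm (hr hK)
      · rw [sw_other e ht]
        apply hr2
        rintro (h | h)
        · exact e (Prod.ext_iff.1 h).1
        · exact ht (Prod.ext_iff.1 h).1
    refine KK_le 0 hr (fun t => ?_) (hall x y)
    by_cases ht : t = u
    · subst ht
      exact no_bridge (p := (τ 0)⁻¹ * (σ * swap w t)) fun s _ hs => hne s hs
    · exact hne t ht
  · intro hg
    obtain ⟨X, hX⟩ := hg.cut
    constructor
    · intro h
      have := not_mc (X := X) hX.cl ?_ h w u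
      · exact hX.hy (this.1 hX.hx)
      · intro t ht
        have h1 : t ≠ w := by rintro rfl; exact ht (Or.inl rfl)
        have h2 : t ≠ u := by rintro rfl; exact ht (Or.inr rfl)
        by_cases htX : t ∈ X
        · exact iff_of_true (hX.int 0 t htX h1) htX
        · exact iff_of_false (hX.out 0 t htX h2) htX
    · intro E' hE'
      apply mc_of
      · intro i c h
        rcases hE'.1 h with h | h <;> exact (Prod.ext_iff.1 h).2
      intro r hr hr2 x y
      obtain ⟨v, hv⟩ : ∃ v, ∀ t, t ≠ v → (t, (0 : Fin 4)) ∉ E' := by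
        by_cases hw : (w, (0 : Fin 4)) ∈ E'
        · by_cases hu : (u, (0 : Fin 4)) ∈ E'
          · exfalso
            apply hE'.2
            rintro z (rfl | rfl)
            · exact hw
            · exact hu
          · refine ⟨w, fun t ht k => ?_⟩
            rcases hE'.1 k with h | h
            · exact ht (Prod.ext_iff.1 h).1
            · exact hu (h ▸ k)
        · refine ⟨u, fun t ht k => ?_⟩
          rcases hE'.1 k with h | h
          · exact hw (h ▸ k)
          · exact ht (Prod.ext_iff.1 h).1
      refine KK_le 0 hr (fun t => ?_) (hc x y)
      by_cases ht : t = v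
      · subst ht
        exact no_bridge (p := (τ 0)⁻¹ * σ) fun s _ hs => hr2 s (hv s hs)
      · exact hr2 t (hv t ht)

/-- The restriction of a decomposed pairing to a bubble. -/
theorem exists_restr (hW : Bub τ W) (hD : Dec τ ρ) (j : Fin (m + 1)) :
    ∃ π : W j ≃ (⇑(τ 0) '' W j : Set (Fin n)), ∀ x : W j, ρ (x : Fin n) = (π x : Fin n) := by
  have h : ∀ x : W j, ρ (x : Fin n) ∈ (⇑(τ 0) '' W j : Set (Fin n)) := fun x =>
    ⟨(τ 0)⁻¹ (ρ x), (hW.iff j x _ x.2).2 ((K τ).symm (dec_rel hD 0 x)), app_inv _ _⟩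
  refine ⟨Equiv.ofBijective (fun x => ⟨ρ x, h x⟩) ⟨?_, ?_⟩, fun x => rfl⟩
  · intro x y e
    exact Subtype.ext (ρ.injective (Subtype.ext_iff.1 e))
  · rintro ⟨_, y, hy, rfl⟩
    refine ⟨⟨ρ⁻¹ (τ 0 y), (hW.iff j y _ hy).2 ?_⟩, Subtype.ext (app_inv _ _)⟩
    have := dec_rel hD 0 (ρ⁻¹ (τ 0 y))
    rwa [app_inv, inv_app] at this

/-- Gluing pairings of the bubbles. -/
theorem exists_glue (hW : Bub τ W) (π : ∀ j, W j ≃ (⇑(τ 0) '' W j : Set (Fin n))) :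
    ∃ ρ : Perm (Fin n), Dec τ ρ ∧ ∀ j (x : W j), ρ (x : Fin n) = (π j x : Fin n) := by
  choose idx hidx using hW.cov
  let f : Fin n → Fin n := fun x => (π (idx x) ⟨x, hidx x⟩ : Fin n)
  have hf : ∀ j (x : W j), f (x : Fin n) = (π j x : Fin n) := by
    rintro j ⟨x, hx⟩
    have e : idx x = j := hW.disj _ _ x (hidx x) hx
    subst e
    rfl
  have hinj : Function.Injective f := by
    intro x y e
    have ex := hf (idx x) ⟨x, hidx x⟩
    have ey := hf (idx y) ⟨y, hidx y⟩
    obtain ⟨a, ha, ha'⟩ := (π (idx x) ⟨x, hidx x⟩).2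
    obtain ⟨b, hb, hb'⟩ := (π (idx y) ⟨y, hidx y⟩).2
    have hab : a = b := (τ 0).injective (by rw [ha', hb', ← ex, ← ey]; exact e)
    subst hab
    have hj : idx x = idx y := hW.disj _ _ a ha hb
    have hy : y ∈ W (idx x) := hj ▸ hidx y
    have ey' := hf (idx x) ⟨y, hy⟩
    have : π (idx x) ⟨x, hidx x⟩ = π (idx x) ⟨y, hy⟩ :=
      Subtype.ext (by rw [← ex, ← ey']; exact e)
    exact Subtype.ext_iff.1 ((π (idx x)).injective this)
  refine ⟨Equiv.ofBijective f (Finite.injective_iff_bijective.1 hinj), ?_, hf⟩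
  refine dec_of_rel 0 fun y => ?_
  change K τ ((τ 0)⁻¹ (f y)) y
  obtain ⟨a, ha, ha'⟩ := (π (idx y) ⟨y, hidx y⟩).2
  rw [hf (idx y) ⟨y, hidx y⟩, ← ha', inv_app]
  exact (hW.iff _ _ _ ha).1 (hidx y)

theorem num_sum (hW : Bub τ W) (p : Perm (Fin n)) (q : ∀ j, Perm (W j))
    (h : ∀ j (x : W j), (q j x : Fin n) = p x) : numCycles p = ∑ j, numCycles (q j) := by
  have hp : ∀ j, ∀ t ∈ W j, p t ∈ W j := fun j t ht => by
    rw [← h j ⟨t, ht⟩]; exact (q j _).2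
  have hq : ∀ j (x y : W j), (q j).SameCycle x y ↔ p.SameCycle x y := by
    intro j x y
    have e : q j = p.subtypePerm (p := fun x => x ∈ W j)
        (fun x => perm_iff_of_mapsTo (hp j) x) := by
      ext x
      exact congrArg Fin.val (h j x)
    rw [e]
    exact Perm.sameCycle_subtypePerm
  unfold numCycles
  rw [← Nat.card_sigma]
  symm
  refine Nat.card_congr (Equiv.ofBijective (fun z : (Σ j, Quotient (permSetoid (q j))) =>
    Quotient.map' (s₂ := permSetoid p) (fun x : W z.1 => (x : Fin n))
      (fun x y k => (hq z.1 x y).1 k) z.2) ⟨?_, ?_⟩)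
  · rintro ⟨i, x⟩ ⟨j, y⟩ e
    induction x using Quotient.inductionOn' with | _ x =>
    induction y using Quotient.inductionOn' with | _ y =>
    have e' : p.SameCycle (x : Fin n) (y : Fin n) := Quotient.exact' e
    have hij : i = j := hW.disj _ _ (y : Fin n) (inv_same (hp i) e' x.2) y.2
    subst hij
    congr 1
    exact Quotient.sound' ((hq i x y).2 e')
  · intro z
    induction z using Quotient.inductionOn' with | _ x =>
    obtain ⟨j, hj⟩ := hW.cov x
    exact ⟨⟨j, Quotient.mk'' ⟨x, hj⟩⟩, rfl⟩

theorem CC_sum (hW : Bub τ W)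
    {r : (j : Fin (m + 1)) → Fin 3 → (W j ≃ (⇑(τ 0) '' W j : Set (Fin n)))}
    (hr : ∀ j i (x : W j), (r j i x : Fin n) = τ i (x : Fin n))
    {π : ∀ j, W j ≃ (⇑(τ 0) '' W j : Set (Fin n))}
    (h : ∀ j (x : W j), ρ (x : Fin n) = (π j x : Fin n)) :
    CC τ ρ = ∑ j, ∑ i, numCycles ((π j).trans (r j i).symm) := by
  unfold CC
  rw [Finset.sum_comm]
  refine Finset.sum_congr rfl fun i _ => ?_
  refine num_sum hW _ (fun j => (π j).trans (r j i).symm) fun j x => ?_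
  rw [Perm.mul_apply, h j x, Equiv.trans_apply]
  symm
  rw [Perm.inv_eq_iff_eq, ← hr, Equiv.apply_symm_apply]

theorem CC_le_of_Mx (hD : Dec τ σ) (hm : IsMx τ σ) (hρ : Dec τ ρ) : CC τ ρ ≤ CC τ σ := by
  have := hm ρ
  unfold Ph at this
  rw [dec_nc hD, dec_nc hρ] at this
  omega

theorem cond_iff (hW : Bub τ W) (hc : ∀ x y, KK τ σ x y) (hD : Dec τ ρ) (w : Fin n) :
    RR τ σ w ((τ 0)⁻¹ (ρ w)) ↔ (σ w = ρ w ∨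
      ((({(w, (0 : Fin 4)), (σ⁻¹ (ρ w), (0 : Fin 4))} : Set (Fin n × Fin 4)).ncard = 2) ∧
        IsEdgeCut (withZero σ τ) {(w, (0 : Fin 4)), (σ⁻¹ (ρ w), (0 : Fin 4))})) := by
  have hK := (K τ).symm (dec_rel hD 0 w)
  rw [RR_iff hK, app_inv]
  by_cases e : σ w = ρ w
  · simp [e]
  have hne : w ≠ σ⁻¹ (ρ w) := fun e' => e (by rw [Perm.eq_inv_iff_eq] at e'; exact e')
  have h2 : ({(w, (0 : Fin 4)), (σ⁻¹ (ρ w), (0 : Fin 4))} : Set (Fin n × Fin 4)).ncard = 2 :=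
    Set.ncard_pair fun k => hne (Prod.ext_iff.1 k).1
  rw [edgeCut_iff hc hne (by rw [app_inv]; exact hK)]
  exact or_congr_right ⟨fun k => ⟨h2, k⟩, fun k => k.2⟩

theorem final (hW : Bub τ W) (hT : TT τ)
    {r : (j : Fin (m + 1)) → Fin 3 → (W j ≃ (⇑(τ 0) '' W j : Set (Fin n)))}
    (hr : ∀ j i (x : W j), (r j i x : Fin n) = τ i (x : Fin n))
    (hc : ∀ x y, KK τ σ x y) :
    IsMx τ σ ↔ ∀ j, MaxTwoCut (withZero σ τ) (W j) (⇑(τ 0) '' W j) (r j) := by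
  constructor
  · intro hm j
    obtain ⟨ρ, hD, hmρ, hR⟩ := exists_pairing hT _ σ rfl hm
    choose π hπ using exists_restr hW hD
    refine ⟨π j, ?_, ?_⟩
    · intro π'
      obtain ⟨ρ', hD', hρ'⟩ := exists_glue hW (Function.update π j π')
      have h1 := CC_le_of_Mx hD hmρ hD'
      rw [CC_sum hW hr hπ, CC_sum hW hr hρ', ← Finset.add_sum_erase _ _ (Finset.mem_univ j),
        ← Finset.add_sum_erase (a := j) _ (fun j => ∑ i, numCycles ((π j).trans (r j i).symm))
          (Finset.mem_univ j)] at h1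
      have h2 : ∑ k ∈ Finset.univ.erase j, ∑ i, numCycles
          ((Function.update π j π' k).trans (r k i).symm) =
          ∑ k ∈ Finset.univ.erase j, ∑ i, numCycles ((π k).trans (r k i).symm) := by
        refine Finset.sum_congr rfl fun k hk => ?_
        rw [Function.update_of_ne (Finset.ne_of_mem_erase hk)]
      rw [h2, Function.update_self] at h1
      exact Nat.le_of_add_le_add_right h1
    · intro w
      have := (cond_iff hW hc hD (w : Fin n)).1 (hR w)
      rwa [hπ j w] at this
  · intro h
    choose π hπ1 hπ2 using h
    obtain ⟨ρ, hD, hρ⟩ := exists_glue hW π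
    have hmρ : IsMx τ ρ := by
      obtain ⟨ρ', hD', hm'⟩ := hT.exists_dec
      choose π' hπ' using exists_restr hW hD'
      have h1 : CC τ ρ' ≤ CC τ ρ := by
        rw [CC_sum hW hr hρ, CC_sum hW hr hπ']
        exact Finset.sum_le_sum fun j _ => hπ1 j (π' j)
      intro ρ''
      refine (hm' ρ'').trans ?_
      unfold Ph
      rw [dec_nc hD, dec_nc hD']
      omega
    have hP := Ph_of_pairing hD _ σ rfl fun w => by
      rw [cond_iff hW hc hD]
      obtain ⟨j, hj⟩ := hW.cov w
      have := hπ2 j ⟨w, hj⟩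
      rw [← hρ j ⟨w, hj⟩] at this
      exact this
    intro ρ''
    rw [hP]
    exact hmρ ρ''

end Final

/-- **Characterization of maximizers when all bubbles but one are planar** (d = 3): if all the
bubbles `W 1, …, W m` of `(τ 0, τ 1, τ 2)` are planar (`W 0` arbitrary), then a permutation
`σ₀` making the colored graph connected maximizes `C_0` among all such connected graphs if and
only if every bubble satisfies the maximal 2-cut property. -/
theorem maximizers_iff_max_two_cut {n m : ℕ} (τ : Fin 3 → Equiv.Perm (Fin n))
    (W : Fin (m + 1) → Set (Fin n))
    (horb : ∀ j, ∃ w : Fin n, W j = MulAction.orbit (bubbleSubgroup τ) w)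
    (hinj : Function.Injective W)
    (hcover : ∀ x : Fin n, ∃ j, x ∈ W j)
    (r : (j : Fin (m + 1)) → Fin 3 → (W j ≃ (⇑(τ 0) '' W j : Set (Fin n))))
    (hr : ∀ j i (x : W j), (r j i x : Fin n) = τ i (x : Fin n))
    (hplanar : ∀ j, j ≠ 0 →
      orbitsIn ((τ 0)⁻¹ * τ 1) (W j) + orbitsIn ((τ 0)⁻¹ * τ 2) (W j) +
        orbitsIn ((τ 1)⁻¹ * τ 2) (W j) = (W j).ncard + 2) :
    ∀ σ₀ : Equiv.Perm (Fin n), ColoredConnected (withZero σ₀ τ) →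
      ((∀ σ₀' : Equiv.Perm (Fin n), ColoredConnected (withZero σ₀' τ) →
          C0 (withZero σ₀' τ) ≤ C0 (withZero σ₀ τ)) ↔
        ∀ j, MaxTwoCut (withZero σ₀ τ) (W j) (⇑(τ 0) '' W j) (r j)) := by
  intro σ₀ hconn
  have hW := bub_of horb hinj hcover
  have hc := conn_iff.1 hconn
  rw [← final hW (main_TT hW hplanar) hr hc, Mx_iff_conn hc]
  simp only [C0_eq, conn_iff]
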